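/- arXiv:0711.4336 — 2 statements merged into one kernel-verified Lean document; each statement's English description precedes it below -/
import Mathlib

section
/- Let n ≥ 1 and let V be a finite-dimensional irreducible (simple) left module over the rational Cherednik algebra H_{0,1}(S_n). If the ℂ-linear operators induced by x₁ and y₁ on the subspace ēV both have only real eigenvalues, then V is the complexification of a real representation: there exists an ℝ-subspace U ⊆ V which is stable under the actions of x₁,…,xₙ, y₁,…,yₙ and of every element of S_n, and such that the natural ℂ-linear map ℂ ⊗_ℝ U → V is bijective. -/
/-- Generators of the rational Cherednik algebra `H_{0,1}(S_n)`:
`x i`, `y i` for `i` an index, and `g σ` for `σ ∈ S_n`. -/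
inductive CherGen (n : ℕ) : Type
  | x : Fin n → CherGen n
  | y : Fin n → CherGen n
  | g : Equiv.Perm (Fin n) → CherGen n

/-- The defining relations of the rational Cherednik algebra `H_{0,1}(S_n)`:
the `g σ` multiply as in the group algebra `ℂ S_n`, `σ x_i σ⁻¹ = x_{σ i}`,
`σ y_i σ⁻¹ = y_{σ i}`, the `x`'s commute, the `y`'s commute,
`[x_i, y_j] = s_{ij}` for `i ≠ j` and `[x_k, y_k] = −∑_{i ≠ k} s_{ik}`
(`s_{ij}` is the transposition `(i j)`). -/
inductive CherRel (n : ℕ) :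
    FreeAlgebra ℂ (CherGen n) → FreeAlgebra ℂ (CherGen n) → Prop
  | g_mul (σ τ : Equiv.Perm (Fin n)) :
      CherRel n (FreeAlgebra.ι ℂ (CherGen.g σ) * FreeAlgebra.ι ℂ (CherGen.g τ))
        (FreeAlgebra.ι ℂ (CherGen.g (σ * τ)))
  | g_one : CherRel n (FreeAlgebra.ι ℂ (CherGen.g 1)) 1
  | g_x (σ : Equiv.Perm (Fin n)) (i : Fin n) :
      CherRel n (FreeAlgebra.ι ℂ (CherGen.g σ) * FreeAlgebra.ι ℂ (CherGen.x i))
        (FreeAlgebra.ι ℂ (CherGen.x (σ i)) * FreeAlgebra.ι ℂ (CherGen.g σ))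
  | g_y (σ : Equiv.Perm (Fin n)) (i : Fin n) :
      CherRel n (FreeAlgebra.ι ℂ (CherGen.g σ) * FreeAlgebra.ι ℂ (CherGen.y i))
        (FreeAlgebra.ι ℂ (CherGen.y (σ i)) * FreeAlgebra.ι ℂ (CherGen.g σ))
  | x_x (i j : Fin n) :
      CherRel n (FreeAlgebra.ι ℂ (CherGen.x i) * FreeAlgebra.ι ℂ (CherGen.x j))
        (FreeAlgebra.ι ℂ (CherGen.x j) * FreeAlgebra.ι ℂ (CherGen.x i))
  | y_y (i j : Fin n) :
      CherRel n (FreeAlgebra.ι ℂ (CherGen.y i) * FreeAlgebra.ι ℂ (CherGen.y j))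
        (FreeAlgebra.ι ℂ (CherGen.y j) * FreeAlgebra.ι ℂ (CherGen.y i))
  | x_y (i j : Fin n) (hij : i ≠ j) :
      CherRel n
        (FreeAlgebra.ι ℂ (CherGen.x i) * FreeAlgebra.ι ℂ (CherGen.y j) -
          FreeAlgebra.ι ℂ (CherGen.y j) * FreeAlgebra.ι ℂ (CherGen.x i))
        (FreeAlgebra.ι ℂ (CherGen.g (Equiv.swap i j)))
  | x_y_same (k : Fin n) :
      CherRel n
        (FreeAlgebra.ι ℂ (CherGen.x k) * FreeAlgebra.ι ℂ (CherGen.y k) -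
          FreeAlgebra.ι ℂ (CherGen.y k) * FreeAlgebra.ι ℂ (CherGen.x k))
        (-∑ i ∈ Finset.univ.erase k, FreeAlgebra.ι ℂ (CherGen.g (Equiv.swap i k)))

/-- The rational Cherednik algebra `H_{0,1}(S_n)`. -/
abbrev CherednikAlgebra (n : ℕ) : Type := RingQuot (CherRel n)

/-- The element `x i` of `H_{0,1}(S_n)`. -/
noncomputable def cherX (n : ℕ) (i : Fin n) : CherednikAlgebra n :=
  RingQuot.mkAlgHom ℂ (CherRel n) (FreeAlgebra.ι ℂ (CherGen.x i))

/-- The element `y i` of `H_{0,1}(S_n)`. -/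
noncomputable def cherY (n : ℕ) (i : Fin n) : CherednikAlgebra n :=
  RingQuot.mkAlgHom ℂ (CherRel n) (FreeAlgebra.ι ℂ (CherGen.y i))

/-- The group element `σ ∈ S_n` inside `H_{0,1}(S_n)`. -/
noncomputable def cherG (n : ℕ) (σ : Equiv.Perm (Fin n)) : CherednikAlgebra n :=
  RingQuot.mkAlgHom ℂ (CherRel n) (FreeAlgebra.ι ℂ (CherGen.g σ))

/-- The symmetrising idempotent `ē = (1/(n−1)!) ∑_{σ ∈ S_{n−1}} σ` of the subgroup `S_{n−1}`
of permutations fixing the first index. -/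
noncomputable def cherE (n : ℕ) (hn : 0 < n) : CherednikAlgebra n :=
  (((n - 1).factorial : ℂ)⁻¹) •
    ∑ σ ∈ Finset.univ.filter (fun σ : Equiv.Perm (Fin n) => σ ⟨0, hn⟩ = ⟨0, hn⟩),
      cherG n σ

universe u

namespace CherednikReal

open Polynomial in
open scoped Pointwise Nat in
theorem exists_finset_span_eq_top_of_prod {R : Type u} [CommRing R] [IsDomain R] (m : ℕ) :
    ∀ (A : Type u) [CommRing A] [Algebra A R] (x : Fin m → R) (P : A[X]), P.Monic →
      P.map (algebraMap A R) = ∏ i, (X - C (x i)) →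
      Algebra.adjoin A (Set.range x) = ⊤ →
      ∃ s : Finset R, s.card ≤ m ! ∧ Submodule.span A (s : Set R) = ⊤ := by
  classical
  induction m with
  | zero =>
    intro A _ _ x P _ _ htop
    refine ⟨{1}, by simp, ?_⟩
    rw [Set.range_eq_empty, Algebra.adjoin_empty] at htop
    rw [Finset.coe_singleton, ← Submodule.one_eq_span, ← Algebra.toSubmodule_bot, htop,
      Algebra.top_toSubmodule]
  | succ m ih =>
    intro A _ _ x P hP hPx htop
    have hdeg : P.natDegree = m + 1 := by
      rw [← hP.natDegree_map (algebraMap A R), hPx, natDegree_prod_of_monic _ _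
        fun i _ => monic_X_sub_C _]
      simp
    have hroot : aeval (x 0) P = 0 := by
      rw [← eval_map_algebraMap, hPx, eval_prod]
      exact Finset.prod_eq_zero (Finset.mem_univ 0) (by simp)
    let x₀ : Algebra.adjoin A {x 0} := ⟨x 0, Algebra.self_mem_adjoin_singleton A (x 0)⟩
    have hroot₀ : aeval x₀ P = 0 := by
      apply Subtype.val_injective
      have := Polynomial.aeval_algHom_apply (Algebra.adjoin A {x 0}).val x₀ P
      simp [x₀, hroot] at this ⊢
    obtain ⟨P', hP'⟩ : ∃ P' : (Algebra.adjoin A {x 0})[X], P' = P.map (algebraMap A _) := ⟨_, rfl⟩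
    have hP'm : P'.Monic := hP' ▸ hP.map _
    have hmul : (X - C x₀) * (P' /ₘ (X - C x₀)) = P' := by
      rw [mul_divByMonic_eq_iff_isRoot, IsRoot.def, hP', eval_map_algebraMap, hroot₀]
    have hQm : (P' /ₘ (X - C x₀)).Monic :=
      (monic_X_sub_C x₀).of_mul_monic_left (by rwa [hmul])
    have hQ : (P' /ₘ (X - C x₀)).map (algebraMap _ R) = ∏ i : Fin m, (X - C (x i.succ)) := by
      have h1 := congrArg (Polynomial.map (algebraMap (Algebra.adjoin A {x 0}) R)) hmul
      have h2 : P'.map (algebraMap (Algebra.adjoin A {x 0}) R) = ∏ i, (X - C (x i)) := by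
        rw [hP', Polynomial.map_map, ← IsScalarTower.algebraMap_eq, hPx]
      rw [h2, Fin.prod_univ_succ, Polynomial.map_mul, Polynomial.map_sub, Polynomial.map_X,
        Polynomial.map_C] at h1
      exact mul_left_cancel₀ (X_sub_C_ne_zero (x 0)) h1
    have htop' : Algebra.adjoin (Algebra.adjoin A {x 0}) (Set.range fun i : Fin m => x i.succ) = ⊤ := by
      rw [eq_top_iff]
      intro r _
      have hr : r ∈ Algebra.adjoin A (Set.range x) := by rw [htop]; trivial
      have hle : Algebra.adjoin A (Set.range x) ≤ (Algebra.adjoin (Algebra.adjoin A {x 0})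
          (Set.range fun i : Fin m => x i.succ)).restrictScalars A := by
        rw [Algebra.adjoin_le_iff]
        rintro _ ⟨i, rfl⟩
        rw [SetLike.mem_coe, Subalgebra.mem_restrictScalars]
        obtain rfl | ⟨i, rfl⟩ := i.eq_zero_or_eq_succ
        · have h := Subalgebra.algebraMap_mem (Algebra.adjoin (Algebra.adjoin A {x 0})
            (Set.range fun i : Fin m => x i.succ)) x₀
          exact h
        · exact Algebra.subset_adjoin ⟨i, rfl⟩
      exact hle hr
    obtain ⟨t, htc, ht⟩ := ih _ _ _ hQm hQ htop'
    let s : Finset (Algebra.adjoin A {x 0}) := (Finset.range P.natDegree).image (x₀ ^ ·)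
    have hs : Submodule.span A (s : Set (Algebra.adjoin A {x 0})) = ⊤ := by
      refine Eq.trans (by congr!) ((Submodule.span_range_natDegree_eq_adjoin hP hroot₀).trans ?_)
      rw [Algebra.toSubmodule_eq_top]
      have := Algebra.adjoin_adjoin_coe_preimage (R := A) (s := {x 0})
      rw [← this]
      congr 1
      ext y
      simp [x₀, Subtype.ext_iff]
    refine ⟨s • t, ?_, ?_⟩
    · rw [Nat.factorial_succ]
      refine Finset.card_smul_le.trans (Nat.mul_le_mul ?_ htc)
      exact Finset.card_image_le.trans (by simp [hdeg])
    · rw [Finset.coe_smul, Submodule.span_smul_of_span_eq_top hs, ht, Submodule.restrictScalars_top]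

open MvPolynomial in
theorem exists_symmetric_spanning_family (n : ℕ) :
    ∃ b : Equiv.Perm (Fin n) → MvPolynomial (Fin n) ℝ, ∀ p, ∃ c : Equiv.Perm (Fin n) →
      MvPolynomial (Fin n) ℝ, (∀ k, (c k).IsSymmetric) ∧ p = ∑ k, c k * b k := by
  classical
  set S := symmetricSubalgebra (Fin n) ℝ
  let Q : Polynomial (MvPolynomial (Fin n) ℝ) := ∏ i, (Polynomial.X - Polynomial.C (X i))
  have hQm : Q.Monic := Polynomial.monic_prod_of_monic _ _ fun i _ => Polynomial.monic_X_sub_C _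
  have hQ : Q ∈ Polynomial.lifts (algebraMap S (MvPolynomial (Fin n) ℝ)) := by
    rw [Polynomial.lifts_iff_coeff_lifts]
    intro k
    refine ⟨⟨Q.coeff k, fun e => ?_⟩, rfl⟩
    have h : Q.map (rename e : MvPolynomial (Fin n) ℝ →ₐ[ℝ] _).toRingHom = Q := by
      simp only [Q, Polynomial.map_prod, Polynomial.map_sub, Polynomial.map_X, Polynomial.map_C]
      simpa using Equiv.prod_comp e
        (fun i => Polynomial.X - Polynomial.C (X i : MvPolynomial (Fin n) ℝ))
    conv_rhs => rw [← h]
    simp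
  obtain ⟨P, hPQ, -, hPm⟩ := Polynomial.lifts_and_natDegree_eq_and_monic hQ hQm
  obtain ⟨s, hsc, hs⟩ := exists_finset_span_eq_top_of_prod n S X P hPm hPQ (by
    rw [eq_top_iff]
    intro p _
    have hp : p ∈ Algebra.adjoin ℝ (Set.range (X : Fin n → MvPolynomial (Fin n) ℝ)) := by
      rw [adjoin_range_X]; trivial
    have hle : Algebra.adjoin ℝ (Set.range (X : Fin n → MvPolynomial (Fin n) ℝ)) ≤
        (Algebra.adjoin S (Set.range X)).restrictScalars ℝ :=
      Algebra.adjoin_le Algebra.subset_adjoin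
    exact hle hp)
  have hcard : Fintype.card s ≤ Fintype.card (Equiv.Perm (Fin n)) := by
    rw [Fintype.card_coe, Fintype.card_perm, Fintype.card_fin]; exact hsc
  obtain ⟨f⟩ := Function.Embedding.nonempty_of_card_le hcard
  refine ⟨Function.extend f (fun p => (p : MvPolynomial (Fin n) ℝ)) 0, fun p => ?_⟩
  have hp : p ∈ Submodule.span S (Set.range (Function.extend f
      (fun p => (p : MvPolynomial (Fin n) ℝ)) 0)) := by
    refine Submodule.span_mono (s := (s : Set (MvPolynomial (Fin n) ℝ))) ?_ (by rw [hs]; trivial)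
    intro q hq
    exact ⟨f ⟨q, hq⟩, f.injective.extend_apply _ _ _⟩
  obtain ⟨c, hc⟩ := (Submodule.mem_span_range_iff_exists_fun S).1 hp
  exact ⟨fun k => c k, fun k => (c k).2, by rw [← hc]; rfl⟩

theorem one_le_det_one_add_sq {ι : Type*} [Fintype ι] [DecidableEq ι] {S : Matrix ι ι ℝ}
    (hS : S.transpose = S) : 1 ≤ (1 + S * S).det := by
  have hH : S.IsHermitian := by
    rw [Matrix.IsHermitian, Matrix.conjTranspose_eq_transpose_of_trivial, hS]
  have h : 1 + S * S = Unitary.conjStarAlgAut ℝ (Matrix ι ι ℝ) hH.eigenvectorUnitary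
      (1 + Matrix.diagonal (RCLike.ofReal ∘ hH.eigenvalues) *
        Matrix.diagonal (RCLike.ofReal ∘ hH.eigenvalues)) := by
    rw [map_add, map_mul, map_one, ← hH.spectral_theorem]
  rw [h, Unitary.conjStarAlgAut_apply, Matrix.det_mul_right_comm,
    Unitary.mul_star_self_of_mem (SetLike.coe_mem _), one_mul,
    Matrix.diagonal_mul_diagonal, ← Matrix.diagonal_one, Matrix.diagonal_add, Matrix.det_diagonal]
  refine (Finset.prod_const_one (s := Finset.univ)).symm.le.trans
    (Finset.prod_le_prod (fun _ _ => zero_le_one) fun i _ => ?_)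
  simpa using mul_self_nonneg (hH.eigenvalues i)
section gaudinOperators
open Matrix Equiv

/-- The matrix of left translation by `σ` on functions on the symmetric group. -/
def leftReg {n : ℕ} (σ : Perm (Fin n)) : Matrix (Perm (Fin n)) (Perm (Fin n)) ℝ :=
  Matrix.of fun w w' => if σ * w' = w then 1 else 0

/-- The Gaudin operator with inhomogeneities `a` and twist `lam`, acting on functions on the
symmetric group. -/
noncomputable def gaudin {n : ℕ} (lam a : Fin n → ℝ) (i : Fin n) :
    Matrix (Perm (Fin n)) (Perm (Fin n)) ℝ :=
  diagonal (fun w => lam (w⁻¹ i)) + ∑ j, (a i - a j)⁻¹ • leftReg (swap i j)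

section gaudin
variable {n : ℕ} (lam a : Fin n → ℝ)

theorem leftReg_mulVec (σ : Perm (Fin n)) (f : Perm (Fin n) → ℝ) (w : Perm (Fin n)) :
    (leftReg σ *ᵥ f) w = f (σ⁻¹ * w) := by
  simp [leftReg, mulVec, dotProduct, ← eq_inv_mul_iff_mul_eq]

theorem leftReg_mul_apply (σ : Perm (Fin n)) (M : Matrix (Perm (Fin n)) (Perm (Fin n)) ℝ)
    (w w' : Perm (Fin n)) : (leftReg σ * M) w w' = M (σ⁻¹ * w) w' := by
  simp [leftReg, Matrix.mul_apply, ← eq_inv_mul_iff_mul_eq]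

theorem leftReg_mul (σ τ : Perm (Fin n)) : leftReg σ * leftReg τ = leftReg (σ * τ) := by
  ext w w'
  rw [leftReg_mul_apply]
  simp [leftReg, eq_inv_mul_iff_mul_eq, mul_assoc]

theorem leftReg_transpose (σ : Perm (Fin n)) : (leftReg σ)ᵀ = leftReg σ⁻¹ := by
  ext w w'
  simp only [leftReg, transpose_apply, of_apply, inv_mul_eq_iff_eq_mul, eq_comm (a := w')]

theorem leftReg_mul_diagonal (σ : Perm (Fin n)) (i : Fin n) :
    leftReg σ * diagonal (fun w : Perm (Fin n) => lam (w⁻¹ i)) =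
      diagonal (fun w : Perm (Fin n) => lam (w⁻¹ (σ i))) * leftReg σ := by
  ext w w'
  simp only [mul_diagonal, diagonal_mul, leftReg, of_apply]
  split_ifs with h
  · subst h; simp
  · simp

theorem gaudin_transpose (i : Fin n) : (gaudin lam a i)ᵀ = gaudin lam a i := by
  simp [gaudin, transpose_sum, leftReg_transpose]

theorem leftReg_mul_gaudin (σ : Perm (Fin n)) (i : Fin n) :
    leftReg σ * gaudin lam (a ∘ σ) i = gaudin lam a (σ i) * leftReg σ := by
  simp only [gaudin, mul_add, add_mul, leftReg_mul_diagonal, Finset.mul_sum, Finset.sum_mul,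
    Matrix.mul_smul, Matrix.smul_mul, leftReg_mul, Function.comp_apply]
  congr 1
  refine (Finset.sum_congr rfl fun j _ => ?_).trans (Equiv.sum_comp σ
    fun j => (a (σ i) - a j)⁻¹ • leftReg (swap (σ i) j * σ))
  rw [Equiv.mul_swap_eq_swap_mul]

theorem inv_sub_cyclic {x y z : ℝ} (hxy : x ≠ y) (hxz : x ≠ z) (hyz : y ≠ z) :
    (x - z)⁻¹ * (y - z)⁻¹ = (x - y)⁻¹ * ((y - z)⁻¹ - (x - z)⁻¹) := by
  have := sub_ne_zero.2 hxy
  have := sub_ne_zero.2 hxz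
  have := sub_ne_zero.2 hyz
  field_simp
  ring

theorem sum_leftReg_comm (ha : Function.Injective a) {i j : Fin n} (hij : i ≠ j) :
    ∑ k, ∑ l, ((a i - a k)⁻¹ * (a j - a l)⁻¹) •
      (leftReg (swap i k * swap j l) - leftReg (swap j l * swap i k)) = 0 := by
  set F : Fin n → Fin n → Matrix (Perm (Fin n)) (Perm (Fin n)) ℝ := fun k l =>
    ((a i - a k)⁻¹ * (a j - a l)⁻¹) •
      (leftReg (swap i k * swap j l) - leftReg (swap j l * swap i k)) with hF
  have hi : ∀ l, F i l = 0 := fun l => by simp [hF]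
  have hj : ∀ k, F k j = 0 := fun k => by simp [hF]
  have hji : F j i = 0 := by simp [hF, Equiv.swap_comm j i]
  have key : ∀ k l, F k l = (if l = k then F k k else 0) + (if k = j then F j l else 0) +
      (if l = i then F k i else 0) := by
    intro k l
    by_cases h1 : l = k
    · subst h1
      by_cases h2 : l = j
      · subst h2; simp [hj, hij.symm]
      · by_cases h3 : l = i
        · subst h3; simp [hi, hij]
        · simp [h2, h3]
    · by_cases h2 : k = j
      · subst h2
        by_cases h3 : l = i
        · subst h3; simp [hji, h1]
        · simp [h1, h3]
      · by_cases h3 : l = i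
        · subst h3; simp [h1, h2]
        · simp only [h1, h2, h3, if_false, add_zero]
          by_cases hki : k = i
          · rw [hki, hi]
          by_cases hlj : l = j
          · rw [hlj, hj]
          have hd : Equiv.Perm.Disjoint (swap i k) (swap j l) := by
            rw [Equiv.Perm.disjoint_iff_disjoint_support, Equiv.Perm.support_swap (Ne.symm hki),
              Equiv.Perm.support_swap (Ne.symm hlj)]
            simp only [Finset.disjoint_insert_left, Finset.disjoint_singleton_left,
              Finset.mem_insert, Finset.mem_singleton, not_or]
            exact ⟨⟨hij, Ne.symm h3⟩, ⟨h2, Ne.symm h1⟩⟩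
          simp [hF, hd.commute.eq]
  have hsum : ∀ m, F m m + F j m + F m i = 0 := by
    intro m
    by_cases hmi : m = i
    · subst hmi; simp [hi, hji]
    by_cases hmj : m = j
    · subst hmj; simp [hj, hji]
    have e1 : swap j m * swap i m = swap i j * swap j m := by
      rw [Equiv.mul_swap_eq_swap_mul]; simp [swap_apply_of_ne_of_ne hij (Ne.symm hmi)]
    have e2 : swap i m * swap j m = swap j m * swap i j := by
      rw [Equiv.mul_swap_eq_swap_mul (swap j m)]
      simp [swap_apply_of_ne_of_ne hij (Ne.symm hmi)]
    have e3 : swap i m * swap i j = swap j m * swap i m := by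
      rw [Equiv.mul_swap_eq_swap_mul]
      simp [swap_apply_of_ne_of_ne hij.symm (Ne.symm hmj), Equiv.swap_comm m j]
    have e4 : swap i j * swap i m = swap j m * swap i j := by
      rw [Equiv.mul_swap_eq_swap_mul]
      simp [swap_apply_of_ne_of_ne hmi hmj, Equiv.swap_comm j m]
    have hinv := inv_sub_cyclic (ha.ne hij) (ha.ne (Ne.symm hmi)) (ha.ne (Ne.symm hmj))
    have hneg : (a j - a i)⁻¹ = -(a i - a j)⁻¹ := by rw [← inv_neg, neg_sub]
    simp only [hF]
    rw [Equiv.swap_comm j i, e3, e4, e2, hneg, ← e1, hinv]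
    module
  calc ∑ k, ∑ l, F k l = ∑ m, (F m m + F j m + F m i) := by
        rw [Finset.sum_congr rfl fun k _ => Finset.sum_congr rfl fun l _ => key k l]
        simp only [Finset.sum_add_distrib, Finset.sum_ite_eq', Finset.mem_univ, if_true]
        congr 2
        rw [Finset.sum_comm]
        simp
    _ = 0 := Finset.sum_eq_zero fun m _ => hsum m

theorem gaudin_commute (ha : Function.Injective a) (i j : Fin n) :
    Commute (gaudin lam a i) (gaudin lam a j) := by
  obtain rfl | hij := eq_or_ne i j
  · exact Commute.refl _
  have h1 : ∑ l, (a j - a l)⁻¹ • (diagonal (fun w : Perm (Fin n) => lam (w⁻¹ i)) *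
      leftReg (swap j l) - leftReg (swap j l) * diagonal (fun w : Perm (Fin n) => lam (w⁻¹ i))) =
      (a j - a i)⁻¹ • ((diagonal (fun w : Perm (Fin n) => lam (w⁻¹ i)) -
        diagonal (fun w : Perm (Fin n) => lam (w⁻¹ j))) * leftReg (swap i j)) := by
    rw [Finset.sum_eq_single i]
    · rw [leftReg_mul_diagonal, swap_apply_right, sub_mul, Equiv.swap_comm]
    · intro l _ hl
      rw [leftReg_mul_diagonal, swap_apply_of_ne_of_ne hij (Ne.symm hl), sub_self, smul_zero]
    · simp
  have h2 : ∑ k, (a i - a k)⁻¹ • (leftReg (swap i k) *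
      diagonal (fun w : Perm (Fin n) => lam (w⁻¹ j)) -
      diagonal (fun w : Perm (Fin n) => lam (w⁻¹ j)) * leftReg (swap i k)) =
      (a i - a j)⁻¹ • ((diagonal (fun w : Perm (Fin n) => lam (w⁻¹ i)) -
        diagonal (fun w : Perm (Fin n) => lam (w⁻¹ j))) * leftReg (swap i j)) := by
    rw [Finset.sum_eq_single j]
    · rw [leftReg_mul_diagonal, swap_apply_right, sub_mul]
    · intro l _ hl
      rw [leftReg_mul_diagonal, swap_apply_of_ne_of_ne hij.symm (Ne.symm hl), sub_self, smul_zero]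
    · simp
  have h3 := sum_leftReg_comm a ha hij
  have hneg : (a j - a i)⁻¹ = -(a i - a j)⁻¹ := by rw [← inv_neg, neg_sub]
  have hd : diagonal (fun w : Perm (Fin n) => lam (w⁻¹ i)) *
      diagonal (fun w : Perm (Fin n) => lam (w⁻¹ j)) =
      diagonal (fun w : Perm (Fin n) => lam (w⁻¹ j)) *
      diagonal (fun w : Perm (Fin n) => lam (w⁻¹ i)) := by
    simp [diagonal_mul_diagonal, mul_comm]
  rw [commute_iff_eq, ← sub_eq_zero]
  have h4 : gaudin lam a i * gaudin lam a j - gaudin lam a j * gaudin lam a i =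
      (∑ l, (a j - a l)⁻¹ • (diagonal (fun w : Perm (Fin n) => lam (w⁻¹ i)) *
      leftReg (swap j l) - leftReg (swap j l) * diagonal (fun w : Perm (Fin n) => lam (w⁻¹ i)))) +
      (∑ k, (a i - a k)⁻¹ • (leftReg (swap i k) *
      diagonal (fun w : Perm (Fin n) => lam (w⁻¹ j)) -
      diagonal (fun w : Perm (Fin n) => lam (w⁻¹ j)) * leftReg (swap i k))) +
      ∑ k, ∑ l, ((a i - a k)⁻¹ * (a j - a l)⁻¹) •
      (leftReg (swap i k * swap j l) - leftReg (swap j l * swap i k)) := by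
    have h5 : ∑ k, ∑ l, ((a i - a k)⁻¹ * (a j - a l)⁻¹) • leftReg (swap j l * swap i k) =
        (∑ l, (a j - a l)⁻¹ • leftReg (swap j l)) * ∑ k, (a i - a k)⁻¹ • leftReg (swap i k) := by
      rw [Finset.sum_mul_sum, Finset.sum_comm]
      simp [leftReg_mul, smul_smul]
    have h6 : ∑ k, ∑ l, ((a i - a k)⁻¹ * (a j - a l)⁻¹) • leftReg (swap i k * swap j l) =
        (∑ k, (a i - a k)⁻¹ • leftReg (swap i k)) * ∑ l, (a j - a l)⁻¹ • leftReg (swap j l) := by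
      rw [Finset.sum_mul_sum]
      refine Finset.sum_congr rfl fun k _ => Finset.sum_congr rfl fun l _ => ?_
      rw [Matrix.smul_mul, Matrix.mul_smul, smul_smul, leftReg_mul]
    simp only [smul_sub, Finset.sum_sub_distrib, h5, h6]
    simp only [gaudin, add_mul, mul_add, hd, Finset.mul_sum, Finset.sum_mul, Matrix.mul_smul,
      Matrix.smul_mul, Finset.sum_add_distrib]
    abel
  rw [h4, h1, h2, h3, hneg]
  module

end gaudin
end gaudinOperators

section polynomialModel
open MvPolynomial Matrix Equiv
variable {n : ℕ}

theorem X_sub_X_dvd_sub_rename_swap (i j : Fin n) (p : MvPolynomial (Fin n) ℝ) :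
    X i - X j ∣ p - rename (swap i j) p := by
  induction p using MvPolynomial.induction_on with
  | C a => simp
  | add p q hp hq =>
    rw [map_add, add_sub_add_comm]
    exact dvd_add hp hq
  | mul_X p k hp =>
    have hk : (X i - X j : MvPolynomial (Fin n) ℝ) ∣ X k - X (swap i j k) := by
      rcases eq_or_ne k i with rfl | hki
      · simp
      rcases eq_or_ne k j with rfl | hkj
      · rw [swap_apply_right]
        exact ⟨-1, by ring⟩
      · simp [swap_apply_of_ne_of_ne hki hkj]
    rw [map_mul, rename_X]
    have : p * X k - rename (swap i j) p * X (swap i j k) =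
        (p - rename (swap i j) p) * X (swap i j k) + p * (X k - X (swap i j k)) := by ring
    rw [this]
    exact dvd_add (hp.mul_right _) (hk.mul_left _)

theorem X_sub_X_ne_zero {i j : Fin n} (hij : i ≠ j) :
    (X i - X j : MvPolynomial (Fin n) ℝ) ≠ 0 :=
  sub_ne_zero.2 fun h => hij (X_injective h)

/-- The divided difference `p ↦ (p - s_{ij} p) / (x_i - x_j)`, with value `0` when `i = j`. -/
noncomputable def divDiff (i j : Fin n) :
    MvPolynomial (Fin n) ℝ →ₗ[ℝ] MvPolynomial (Fin n) ℝ :=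
  if hij : i = j then 0 else
    { toFun := fun p => (X_sub_X_dvd_sub_rename_swap i j p).choose
      map_add' := fun p q => by
        refine mul_left_cancel₀ (X_sub_X_ne_zero hij) ?_
        rw [mul_add, ← (X_sub_X_dvd_sub_rename_swap i j (p + q)).choose_spec,
          ← (X_sub_X_dvd_sub_rename_swap i j p).choose_spec,
          ← (X_sub_X_dvd_sub_rename_swap i j q).choose_spec, map_add]
        ring
      map_smul' := fun c p => by
        refine mul_left_cancel₀ (X_sub_X_ne_zero hij) ?_
        rw [RingHom.id_apply, mul_smul_comm,
          ← (X_sub_X_dvd_sub_rename_swap i j (c • p)).choose_spec,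
          ← (X_sub_X_dvd_sub_rename_swap i j p).choose_spec, map_smul, smul_sub] }

theorem X_sub_X_mul_divDiff (i j : Fin n) (p : MvPolynomial (Fin n) ℝ) :
    (X i - X j) * divDiff i j p = p - rename (swap i j) p := by
  by_cases hij : i = j
  · subst hij
    simp
  · simp only [divDiff, hij, dif_neg, not_false_eq_true]
    exact (X_sub_X_dvd_sub_rename_swap i j p).choose_spec.symm

@[simp] theorem divDiff_self (i : Fin n) (p : MvPolynomial (Fin n) ℝ) : divDiff i i p = 0 := by
  simp [divDiff]

theorem divDiff_eq_of_mul_eq {i j : Fin n} (hij : i ≠ j) {p q : MvPolynomial (Fin n) ℝ}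
    (h : (X i - X j) * q = p - rename (swap i j) p) : divDiff i j p = q :=
  mul_left_cancel₀ (X_sub_X_ne_zero hij) (by rw [h, X_sub_X_mul_divDiff])

theorem divDiff_mul (i j : Fin n) (p q : MvPolynomial (Fin n) ℝ) :
    divDiff i j (p * q) = divDiff i j p * rename (swap i j) q + p * divDiff i j q := by
  rcases eq_or_ne i j with rfl | hij
  · simp
  refine divDiff_eq_of_mul_eq hij ?_
  rw [map_mul]
  linear_combination rename (swap i j) q * X_sub_X_mul_divDiff i j p +
    p * X_sub_X_mul_divDiff i j q

theorem divDiff_of_isSymmetric (i j : Fin n) {c : MvPolynomial (Fin n) ℝ} (hc : c.IsSymmetric) :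
    divDiff i j c = 0 := by
  rcases eq_or_ne i j with rfl | hij
  · simp
  exact divDiff_eq_of_mul_eq hij (by rw [hc, mul_zero, sub_self])

theorem divDiff_X_self {i j : Fin n} (hij : i ≠ j) :
    divDiff i j (X i : MvPolynomial (Fin n) ℝ) = 1 :=
  divDiff_eq_of_mul_eq hij (by simp)

theorem divDiff_X_right {i j : Fin n} (hij : i ≠ j) :
    divDiff i j (X j : MvPolynomial (Fin n) ℝ) = -1 :=
  divDiff_eq_of_mul_eq hij (by simp)

theorem divDiff_X_of_ne {i j k : Fin n} (hki : k ≠ i) (hkj : k ≠ j) :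
    divDiff i j (X k : MvPolynomial (Fin n) ℝ) = 0 := by
  rcases eq_or_ne i j with rfl | hij
  · simp
  exact divDiff_eq_of_mul_eq hij (by simp [swap_apply_of_ne_of_ne hki hkj])

theorem eval_divDiff {a : Fin n → ℝ} (ha : Function.Injective a) (i j : Fin n)
    (p : MvPolynomial (Fin n) ℝ) :
    eval a (divDiff i j p) = (a i - a j)⁻¹ * (eval a p - eval a (rename (swap i j) p)) := by
  rcases eq_or_ne i j with rfl | hij
  · simp
  have h := congrArg (eval a) (X_sub_X_mul_divDiff i j p)
  simp only [map_mul, map_sub, eval_X] at h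
  rw [← h, inv_mul_cancel_left₀ (sub_ne_zero.2 (ha.ne hij))]

/-- The polynomial model of the module induced from a character of the subalgebra generated
by the `y i`: polynomials tensored with the regular representation of the symmetric group. -/
abbrev PolyModel (n : ℕ) : Type := Perm (Fin n) → MvPolynomial (Fin n) ℝ

/-- Multiplication by `x i` on the polynomial model. -/
noncomputable def modelX (i : Fin n) : Module.End ℝ (PolyModel n) where
  toFun m w := X i * m w
  map_add' m m' := by ext1 w; simp [mul_add]
  map_smul' c m := by ext1 w; simp

/-- The diagonal action of a permutation on the polynomial model. -/
noncomputable def modelG (σ : Perm (Fin n)) : Module.End ℝ (PolyModel n) where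
  toFun m w := rename σ (m (σ⁻¹ * w))
  map_add' m m' := by ext1 w; simp
  map_smul' c m := by ext1 w; simp

/-- The Dunkl operator on the polynomial model. -/
noncomputable def modelY (lam : Fin n → ℝ) (i : Fin n) : Module.End ℝ (PolyModel n) where
  toFun m w := lam (w⁻¹ i) • m w + ∑ j, divDiff i j (m (swap i j * w))
  map_add' m m' := by ext1 w; simp [Finset.sum_add_distrib]; abel
  map_smul' c m := by ext1 w; simp [smul_comm c, Finset.smul_sum]

/-- The action of words in the Cherednik generators on the polynomial model. -/
noncomputable def modelRep (lam : Fin n → ℝ) :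
    FreeAlgebra ℝ (CherGen n) →ₐ[ℝ] Module.End ℝ (PolyModel n) :=
  FreeAlgebra.lift ℝ fun
    | .x i => modelX i
    | .y i => modelY lam i
    | .g σ => modelG σ

/-- The symmetriser over the symmetric group, as a word in the Cherednik generators. -/
noncomputable def freeSymm (n : ℕ) : FreeAlgebra ℝ (CherGen n) :=
  ((n.factorial : ℝ)⁻¹) • ∑ σ : Perm (Fin n), FreeAlgebra.ι ℝ (CherGen.g σ)

/-- The invariant element of the polynomial model attached to a polynomial. -/
noncomputable def orbitMap (p : MvPolynomial (Fin n) ℝ) : PolyModel n := fun w => rename w p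

/-- Pointwise evaluation of an element of the polynomial model. -/
noncomputable def evalAt (a : Fin n → ℝ) (m : PolyModel n) : Perm (Fin n) → ℝ :=
  fun w => eval a (m w)

theorem modelG_mul (σ τ : Perm (Fin n)) (m : PolyModel n) :
    modelG σ (modelG τ m) = modelG (σ * τ) m := by
  ext1 w
  simp only [modelG, LinearMap.coe_mk, AddHom.coe_mk, rename_rename, ← Perm.coe_mul,
    _root_.mul_inv_rev, mul_assoc]

theorem eq_orbitMap {m : PolyModel n} (hm : ∀ σ, modelG σ m = m) : m = orbitMap (m 1) := by
  ext1 w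
  have := congrFun (hm w) w
  simpa [modelG, orbitMap] using this.symm

theorem modelRep_freeSymm (lam : Fin n → ℝ) (m : PolyModel n) :
    modelRep lam (freeSymm n) m = ((n.factorial : ℝ)⁻¹) • ∑ σ, modelG σ m := by
  simp [freeSymm, modelRep, LinearMap.sum_apply]

theorem modelRep_freeSymm_eq_orbitMap (lam : Fin n → ℝ) (m : PolyModel n) :
    ∃ p, modelRep lam (freeSymm n) m = orbitMap p := by
  refine ⟨_, eq_orbitMap fun σ => ?_⟩
  rw [modelRep_freeSymm, map_smul, map_sum]
  simp only [modelG_mul]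
  exact congrArg _ (Equiv.sum_comp (Equiv.mulLeft σ) fun τ => modelG τ m)

theorem evalAt_modelG (a : Fin n → ℝ) (σ : Perm (Fin n)) (m : PolyModel n) :
    evalAt a (modelG σ m) = leftReg σ *ᵥ evalAt (a ∘ σ) m := by
  ext w
  rw [leftReg_mulVec]
  simp [evalAt, modelG, eval_rename]

theorem evalAt_comp_orbitMap (a : Fin n → ℝ) (σ : Perm (Fin n)) (p : MvPolynomial (Fin n) ℝ) :
    evalAt (a ∘ σ) (orbitMap p) = leftReg σ⁻¹ *ᵥ evalAt a (orbitMap p) := by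
  ext w
  rw [leftReg_mulVec]
  simp only [evalAt, orbitMap, eval_rename]
  rfl

theorem evalAt_modelY {a : Fin n → ℝ} (ha : Function.Injective a) (lam : Fin n → ℝ) (i : Fin n)
    (m : PolyModel n) :
    evalAt a (modelY lam i m) = gaudin lam a i *ᵥ evalAt a m -
      ∑ j, (a i - a j)⁻¹ • evalAt a (modelG (swap i j) m) := by
  ext w
  simp only [gaudin, add_mulVec, Pi.add_apply, Pi.sub_apply, mulVec_diagonal, Finset.sum_apply,
    Pi.smul_apply, Matrix.sum_mulVec, smul_mulVec, leftReg_mulVec, smul_eq_mul, swap_inv]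
  simp only [evalAt, modelY, modelG, LinearMap.coe_mk, AddHom.coe_mk, map_add, map_sum,
    eval_divDiff ha, smul_eval, mul_sub, Finset.sum_sub_distrib, swap_inv]
  ring

/-- An operator on the polynomial model whose restriction to invariants is given, at each regular
point, by a symmetric matrix commuting with the Gaudin operators. -/
def IsGaudinType (lam : Fin n → ℝ) (D : Module.End ℝ (PolyModel n)) : Prop :=
  ∀ a : Fin n → ℝ, Function.Injective a → ∃ S : Matrix (Perm (Fin n)) (Perm (Fin n)) ℝ,
    Sᵀ = S ∧ (∀ i, Commute (gaudin lam a i) S) ∧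
    ∀ p, evalAt a (D (orbitMap p)) = S *ᵥ evalAt a (orbitMap p)

namespace IsGaudinType
variable {lam : Fin n → ℝ} {D D' : Module.End ℝ (PolyModel n)}

theorem one : IsGaudinType lam (1 : Module.End ℝ (PolyModel n)) := fun a _ =>
  ⟨1, transpose_one, fun _ => Commute.one_right _, fun p => by simp⟩

theorem add (h : IsGaudinType lam D) (h' : IsGaudinType lam D') :
    IsGaudinType lam (D + D') := fun a ha => by
  obtain ⟨S, hS, hc, he⟩ := h a ha
  obtain ⟨S', hS', hc', he'⟩ := h' a ha
  refine ⟨S + S', by rw [transpose_add, hS, hS'], fun i => (hc i).add_right (hc' i), fun p => ?_⟩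
  rw [add_mulVec, ← he, ← he']
  ext w
  simp [evalAt]

theorem smul (r : ℝ) (h : IsGaudinType lam D) : IsGaudinType lam (r • D) := fun a ha => by
  obtain ⟨S, hS, hc, he⟩ := h a ha
  refine ⟨r • S, by rw [transpose_smul, hS], fun i => (hc i).smul_right r, fun p => ?_⟩
  rw [smul_mulVec, ← he]
  ext w
  simp [evalAt]

theorem modelX_mul (i : Fin n) (h : IsGaudinType lam D) :
    IsGaudinType lam (modelX i * D) := fun a ha => by
  obtain ⟨S, hS, hc, he⟩ := h a ha
  refine ⟨a i • S, by rw [transpose_smul, hS], fun j => (hc j).smul_right _, fun p => ?_⟩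
  rw [smul_mulVec, ← he]
  ext w
  simp [evalAt, modelX]

theorem modelG_mul (σ : Perm (Fin n)) (h : IsGaudinType lam D) :
    IsGaudinType lam (modelG σ * D) := fun a ha => by
  obtain ⟨S, hS, hc, he⟩ := h (a ∘ σ) (ha.comp σ.injective)
  refine ⟨leftReg σ * S * leftReg σ⁻¹, ?_, fun i => ?_, fun p => ?_⟩
  · simp [leftReg_transpose, hS, Matrix.mul_assoc]
  · have h1 := leftReg_mul_gaudin lam a σ (σ⁻¹ i)
    have h2 := leftReg_mul_gaudin lam (a ∘ σ) σ⁻¹ i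
    have h3 : (a ∘ σ) ∘ ⇑σ⁻¹ = a := by ext; simp
    rw [show σ (σ⁻¹ i) = i by simp] at h1
    rw [h3] at h2
    rw [commute_iff_eq, ← Matrix.mul_assoc, ← Matrix.mul_assoc, ← h1, Matrix.mul_assoc _ _ S,
      (hc _).eq, Matrix.mul_assoc _ (leftReg σ⁻¹), h2]
    simp only [Matrix.mul_assoc]
  · rw [Module.End.mul_apply, evalAt_modelG, he, evalAt_comp_orbitMap, mulVec_mulVec,
      mulVec_mulVec, Matrix.mul_assoc]

theorem modelY_mul (i : Fin n) (h : IsGaudinType lam D) :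
    IsGaudinType lam (modelY lam i * D) := fun a ha => by
  obtain ⟨S, hS, hc, he⟩ := h a ha
  choose S' hS' hc' he' using fun j => h.modelG_mul (swap i j) a ha
  refine ⟨gaudin lam a i * S - ∑ j, (a i - a j)⁻¹ • S' j, ?_, fun j => ?_, fun p => ?_⟩
  · rw [transpose_sub, transpose_mul, hS, gaudin_transpose, ← (hc i).eq, transpose_sum]
    simp [hS']
  · exact ((gaudin_commute lam a ha j i).mul_right (hc j)).sub_right
      (Commute.sum_right _ _ _ fun k _ => (hc' k j).smul_right _)
  · rw [Module.End.mul_apply, evalAt_modelY ha, he, sub_mulVec, mulVec_mulVec,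
      Matrix.sum_mulVec]
    simp only [smul_mulVec, ← he', Module.End.mul_apply]

end IsGaudinType

theorem isGaudinType_modelRep (lam : Fin n → ℝ) (f : FreeAlgebra ℝ (CherGen n)) :
    IsGaudinType lam (modelRep lam f) := by
  suffices h : ∀ D, IsGaudinType lam D → IsGaudinType lam (modelRep lam f * D) by
    simpa using h 1 IsGaudinType.one
  induction f using FreeAlgebra.induction with
  | grade0 r =>
    intro D hD
    simpa [Algebra.algebraMap_eq_smul_one] using hD.smul r
  | grade1 z =>
    intro D hD
    rw [modelRep, FreeAlgebra.lift_ι_apply]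
    cases z with
    | x i => exact hD.modelX_mul i
    | y i => exact hD.modelY_mul i
    | g σ => exact hD.modelG_mul σ
  | mul f g hf hg => intro D hD; rw [map_mul, mul_assoc]; exact hf _ (hg _ hD)
  | add f g hf hg => intro D hD; rw [map_add, add_mul]; exact (hf _ hD).add (hg _ hD)

theorem exists_interpolation {a : Fin n → ℝ} (ha : Function.Injective a) (w : Perm (Fin n)) :
    ∃ p, evalAt a (orbitMap p) = Pi.single w 1 := by
  have h : ∀ w' : Perm (Fin n), ∃ q : MvPolynomial (Fin n) ℝ,
      eval (a ∘ w) q = 1 ∧ (w' ≠ w → eval (a ∘ w') q = 0) := by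
    intro w'
    by_cases hw : w' = w
    · exact ⟨1, by simp, fun h => absurd hw h⟩
    obtain ⟨i, hi⟩ : ∃ i, w' i ≠ w i := not_forall.1 fun h => hw (Equiv.ext h)
    refine ⟨C (a (w i) - a (w' i))⁻¹ * (X i - C (a (w' i))), ?_, fun _ => by simp⟩
    simpa using inv_mul_cancel₀ (sub_ne_zero.2 (ha.ne hi.symm))
  choose q hq hq' using h
  refine ⟨∏ w', q w', ?_⟩
  ext w'
  simp only [evalAt, orbitMap, eval_rename, map_prod]
  rcases eq_or_ne w' w with rfl | hw
  · simp [hq]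
  · rw [Pi.single_eq_of_ne hw]
    exact Finset.prod_eq_zero (Finset.mem_univ w') (hq' w' hw)

theorem dense_injective_translates (a v : Fin n → ℝ) (hv : Function.Injective v) :
    Dense {t : ℝ | Function.Injective (a + t • v)} := by
  have hfin : Set.Finite {t : ℝ | ¬ Function.Injective (a + t • v)} := by
    refine (Set.finite_range fun ij : Fin n × Fin n =>
      (a ij.1 - a ij.2) / (v ij.2 - v ij.1)).subset ?_
    intro t ht
    simp only [Set.mem_ofPred_eq, Function.Injective, not_forall] at ht
    obtain ⟨i, j, h, hij⟩ := ht
    refine ⟨(i, j), ?_⟩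
    simp only [Pi.add_apply, Pi.smul_apply, smul_eq_mul] at h
    rw [div_eq_iff (sub_ne_zero.2 (hv.ne (Ne.symm hij)))]
    linarith
  simpa [Set.compl_ofPred] using hfin.countable.dense_compl ℝ

/-- The symmetrised action of a word on invariants has a matrix over symmetric polynomials whose
specialisations have no eigenvalue `± i`. -/
theorem exists_modelRep_matrix (lam : Fin n → ℝ) (f : FreeAlgebra ℝ (CherGen n))
    {b : Perm (Fin n) → MvPolynomial (Fin n) ℝ}
    (hb : ∀ p, ∃ c : Perm (Fin n) → MvPolynomial (Fin n) ℝ,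
      (∀ k, (c k).IsSymmetric) ∧ p = ∑ k, c k * b k) :
    ∃ N : Matrix (Perm (Fin n)) (Perm (Fin n)) (MvPolynomial (Fin n) ℝ),
      (∀ l k, (N l k).IsSymmetric) ∧
      (∀ k, modelRep lam (freeSymm n * f) (orbitMap (b k)) = ∑ l, N l k • orbitMap (b l)) ∧
      ∀ a, 1 ≤ (1 + N.map (eval a) * N.map (eval a)).det := by
  have horb : ∀ c : Perm (Fin n) → MvPolynomial (Fin n) ℝ, (∀ k, (c k).IsSymmetric) →
      orbitMap (∑ k, c k * b k) = ∑ k, c k • orbitMap (b k) := by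
    intro c hc
    ext1 w
    simp [orbitMap, Finset.sum_apply, hc _ w]
  have hex : ∀ k, ∃ c : Perm (Fin n) → MvPolynomial (Fin n) ℝ, (∀ l, (c l).IsSymmetric) ∧
      modelRep lam (freeSymm n * f) (orbitMap (b k)) = ∑ l, c l • orbitMap (b l) := by
    intro k
    obtain ⟨p, hp⟩ := modelRep_freeSymm_eq_orbitMap lam (modelRep lam f (orbitMap (b k)))
    obtain ⟨c, hc, hpc⟩ := hb p
    exact ⟨c, hc, by rw [map_mul, Module.End.mul_apply, hp, hpc, horb c hc]⟩
  choose c hc hcm using hex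
  refine ⟨Matrix.of fun l k => c k l, fun l k => hc k l, hcm, fun a => ?_⟩
  have hreg : ∀ a : Fin n → ℝ, Function.Injective a →
      1 ≤ (1 + (Matrix.of fun l k => c k l).map (eval a) *
        (Matrix.of fun l k => c k l).map (eval a)).det := by
    intro a ha
    obtain ⟨S, hS, -, he⟩ := isGaudinType_modelRep lam (freeSymm n * f) a ha
    set N := (Matrix.of fun l k => c k l).map (eval a) with hN
    let B : Matrix (Perm (Fin n)) (Perm (Fin n)) ℝ := Matrix.of fun w k => evalAt a (orbitMap (b k)) w
    have hsum : ∀ d : Perm (Fin n) → MvPolynomial (Fin n) ℝ,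
        evalAt a (∑ k, d k • orbitMap (b k)) = B *ᵥ fun k => eval a (d k) := by
      intro d
      ext w
      simp [evalAt, B, mulVec, dotProduct, Finset.sum_apply, mul_comm]
    have hBN : B * N = S * B := by
      ext w k
      have h := congrFun (he (b k)) w
      rw [hcm, hsum] at h
      exact h
    choose p hp using exists_interpolation ha
    choose d hd hpd using fun w => hb (p w)
    have hBC : B * (Matrix.of fun k w => eval a (d w k)) = 1 := by
      ext w w'
      have h := congrFun (hp w') w
      rw [hpd, horb _ (hd w'), hsum] at h
      rw [Matrix.one_apply, ← Pi.single_apply, ← h]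
      rfl
    set C := (Matrix.of fun k w => eval a (d w k))
    have hS' : S = B * N * C := by rw [hBN, Matrix.mul_assoc, hBC, Matrix.mul_one]
    have hCB : C * B = 1 := mul_eq_one_comm.1 hBC
    have hconj : 1 + S * S = B * (1 + N * N) * C := by
      have : B * N * C * (B * N * C) = B * N * (C * B) * N * C := by simp only [Matrix.mul_assoc]
      rw [hS', this, hCB, Matrix.mul_one, Matrix.mul_add, Matrix.add_mul, Matrix.mul_one, hBC]
      simp only [Matrix.mul_assoc]
    have hdet := one_le_det_one_add_sq hS
    rwa [hconj, Matrix.det_mul_right_comm, hBC, Matrix.one_mul] at hdet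
  have hv : Function.Injective fun i : Fin n => (i : ℝ) := fun i j h =>
    Fin.ext (Nat.cast_injective h)
  have hclosed : IsClosed {t : ℝ | 1 ≤ (1 + (Matrix.of fun l k => c k l).map
      (eval (a + t • fun i : Fin n => ((i : ℕ) : ℝ))) * (Matrix.of fun l k => c k l).map
      (eval (a + t • fun i : Fin n => ((i : ℕ) : ℝ)))).det} := by
    have hcont : Continuous fun t : ℝ => (Matrix.of fun l k => c k l).map
        (eval (a + t • fun i : Fin n => ((i : ℕ) : ℝ))) := by
      refine continuous_matrix fun l k => ?_
      exact (MvPolynomial.continuous_eval (c k l)).comp (by fun_prop)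
    exact isClosed_le continuous_const
      (continuous_const.add (hcont.matrix_mul hcont)).matrix_det
  have hall := (dense_injective_translates a _ hv).closure_eq ▸
    hclosed.closure_subset_iff.2 fun t ht => hreg _ ht
  simpa using hall (Set.mem_univ 0)

end polynomialModel

section representation
open MvPolynomial Equiv

/-- A representation of the rational Cherednik algebra `H_{0,1}(S_n)`, given by the operators
attached to the generators. -/
structure CherRep (n : ℕ) (V : Type*) [AddCommGroup V] [Module ℂ V] where
  /-- The operators `x i`. -/
  x : Fin n → Module.End ℂ V
  /-- The operators `y i`. -/
  y : Fin n → Module.End ℂ V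
  /-- The action of the symmetric group. -/
  g : Perm (Fin n) →* Module.End ℂ V
  g_x (σ : Perm (Fin n)) (i : Fin n) : g σ * x i = x (σ i) * g σ
  g_y (σ : Perm (Fin n)) (i : Fin n) : g σ * y i = y (σ i) * g σ
  x_x (i j : Fin n) : x i * x j = x j * x i
  y_y (i j : Fin n) : y i * y j = y j * y i
  x_y (i j : Fin n) (hij : i ≠ j) : x i * y j - y j * x i = g (swap i j)
  x_y_same (k : Fin n) : x k * y k - y k * x k = -∑ i ∈ Finset.univ.erase k, g (swap i k)

namespace CherRep
variable {n : ℕ} {V : Type*} [AddCommGroup V] [Module ℂ V] (R : CherRep n V)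

/-- The Fourier transform `(x, y) ↦ (y, -x)` of a representation. -/
def fourier : CherRep n V where
  x := R.y
  y i := -R.x i
  g := R.g
  g_x := R.g_y
  g_y σ i := by rw [mul_neg, neg_mul, R.g_x]
  x_x := R.y_y
  y_y i j := by rw [neg_mul_neg, neg_mul_neg, R.x_x]
  x_y i j hij := by
    rw [swap_comm, ← R.x_y j i hij.symm, mul_neg, neg_mul, neg_sub_neg]
  x_y_same k := by
    rw [← R.x_y_same k, mul_neg, neg_mul, neg_sub_neg]

theorem g_mul_g_apply (σ τ : Perm (Fin n)) (v : V) : R.g σ (R.g τ v) = R.g (σ * τ) v := by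
  rw [map_mul, Module.End.mul_apply]

theorem g_ne_zero (σ : Perm (Fin n)) {v : V} (hv : v ≠ 0) : R.g σ v ≠ 0 := fun h => hv <| by
  have := R.g_mul_g_apply σ⁻¹ σ v
  rw [h, map_zero, inv_mul_cancel, map_one, Module.End.one_apply] at this
  exact this.symm

theorem trace_g_mul (w : Perm (Fin n)) (i : Fin n) (hw : w i ≠ i) (P : Module.End ℂ V)
    (hP : Commute (R.x i) P) : LinearMap.trace ℂ V (R.g w * P) = 0 := by
  set B := R.g (swap i (w i) * w) * P with hB
  have hcomm : Commute (R.x i) B := by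
    refine Commute.mul_right ?_ hP
    have := R.g_x (swap i (w i) * w) i
    rw [Perm.mul_apply, swap_apply_right] at this
    exact this.symm
  have hwB : R.g w * P = R.g (swap i (w i)) * B := by
    rw [hB, ← mul_assoc, ← map_mul, swap_mul_self_mul]
  rw [hwB, ← R.x_y i (w i) hw.symm, sub_mul, map_sub, sub_eq_zero, mul_assoc, mul_assoc, hcomm.eq,
    LinearMap.trace_mul_comm, mul_assoc]

theorem exists_invariant [FiniteDimensional ℂ V] [Nontrivial V] :
    ∃ v : V, v ≠ 0 ∧ ∀ σ, R.g σ v = v := by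
  have htr : LinearMap.trace ℂ V (∑ σ, R.g σ) ≠ 0 := by
    rw [map_sum, Finset.sum_eq_single 1]
    · rw [map_one, LinearMap.trace_one]
      exact Nat.cast_ne_zero.2 Module.finrank_pos.ne'
    · intro w _ hw
      obtain ⟨i, hi⟩ : ∃ i, w i ≠ i := not_forall.1 fun h => hw (Equiv.ext h)
      simpa using R.trace_g_mul w i hi 1 (Commute.one_right _)
    · simp
  obtain ⟨u, hu⟩ : ∃ u, (∑ σ, R.g σ) u ≠ 0 := by
    by_contra! h
    exact htr (by rw [show ∑ σ, R.g σ = 0 from LinearMap.ext h, map_zero])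
  refine ⟨_, hu, fun τ => ?_⟩
  simp only [LinearMap.sum_apply, map_sum, R.g_mul_g_apply]
  exact Equiv.sum_comp (Equiv.mulLeft τ) fun σ => R.g σ u

/-- The sum over the stabiliser of an index. -/
noncomputable def stabSum (i : Fin n) : Module.End ℂ V :=
  ∑ σ with σ i = i, R.g σ

theorem commute_x_stabSum (i : Fin n) : Commute (R.x i) (R.stabSum i) := by
  refine Commute.sum_right _ _ _ fun σ hσ => ?_
  have := R.g_x σ i
  rw [(Finset.mem_filter.1 hσ).2] at this
  exact this.symm

theorem trace_stabSum_mul (i : Fin n) (P : Module.End ℂ V)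
    (hP : ∀ j, Commute (R.x j) P) :
    LinearMap.trace ℂ V (R.stabSum i * P) = LinearMap.trace ℂ V P := by
  rw [stabSum, Finset.sum_mul, map_sum, Finset.sum_eq_single 1]
  · rw [map_one, one_mul]
  · intro w _ hw
    obtain ⟨j, hj⟩ : ∃ j, w j ≠ j := not_forall.1 fun h => hw (Equiv.ext h)
    exact R.trace_g_mul w j hj P (hP j)
  · simp

theorem exists_spectral_idempotent [FiniteDimensional ℂ V] (f : Module.End ℂ V)
    {z : ℂ} {v : V} (hv : v ≠ 0) (hfv : f v = z • v) : ∃ (q : Polynomial ℂ) (k : ℕ),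
      IsIdempotentElem (Polynomial.aeval f q) ∧ Polynomial.aeval f q ≠ 0 ∧
      (f - algebraMap ℂ _ z) ^ k * Polynomial.aeval f q = 0 := by
  have hm : minpoly ℂ f ≠ 0 := minpoly.ne_zero (Algebra.IsIntegral.isIntegral f)
  obtain ⟨q, hq, hdvd⟩ := Polynomial.exists_eq_pow_rootMultiplicity_mul_and_not_dvd _ hm z
  set k := (minpoly ℂ f).rootMultiplicity z
  have hcop : IsCoprime ((Polynomial.X - Polynomial.C z) ^ k) q :=
    ((Polynomial.irreducible_X_sub_C z).coprime_iff_not_dvd.2 hdvd).pow_left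
  obtain ⟨a, b, hab⟩ := hcop
  have h0 : Polynomial.aeval f ((Polynomial.X - Polynomial.C z) ^ k) *
      Polynomial.aeval f q = 0 := by rw [← map_mul, ← hq, minpoly.aeval]
  have h1 : Polynomial.aeval f ((Polynomial.X - Polynomial.C z) ^ k) *
      Polynomial.aeval f (b * q) = 0 := by
    rw [mul_comm b, map_mul, ← mul_assoc, h0, zero_mul]
  have h2 : Polynomial.aeval f (b * q) =
      1 - Polynomial.aeval f a * Polynomial.aeval f ((Polynomial.X - Polynomial.C z) ^ k) := by
    rw [← map_mul, ← map_one (Polynomial.aeval (R := ℂ) f), ← map_sub, ← hab]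
    congr 1
    ring
  refine ⟨b * q, k, ?_, fun h => ?_, by simpa using h1⟩
  · rw [IsIdempotentElem]
    nth_rw 1 [h2]
    rw [sub_mul, one_mul, mul_assoc, h1, mul_zero, sub_zero]
  · have hk : k ≠ 0 := by
      have : f.HasEigenvalue z := Module.End.hasEigenvalue_of_hasEigenvector
        (Module.End.hasEigenvector_iff.2 ⟨Module.End.mem_eigenspace_iff.2 hfv, hv⟩)
      exact ((Polynomial.rootMultiplicity_pos hm).2 (Module.End.isRoot_of_hasEigenvalue this)).ne'
    have h3 : Polynomial.aeval f ((Polynomial.X - Polynomial.C z) ^ k) v = 0 := by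
      obtain ⟨k', hk'⟩ := Nat.exists_eq_succ_of_ne_zero hk
      simp [hk', pow_succ, hfv, Algebra.algebraMap_eq_smul_one]
    have := congrArg (fun F => F v) (h.symm.trans h2)
    simp only [LinearMap.sub_apply, Module.End.mul_apply, h3, map_zero] at this
    exact hv (by simpa using this.symm)

theorem im_eq_zero_of_x_apply_eq [FiniteDimensional ℂ V] (i₀ : Fin n)
    (hreal : ∀ z : ℂ, (∃ v : V, v ≠ 0 ∧ (∃ w, v = R.stabSum i₀ w) ∧ R.x i₀ v = z • v) → z.im = 0)
    (i : Fin n) {z : ℂ} {v : V} (hv : v ≠ 0) (hxv : R.x i v = z • v) : z.im = 0 := by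
  have hv' : R.x i₀ (R.g (swap i i₀) v) = z • R.g (swap i i₀) v := by
    have := congrArg (fun F => F v) (R.g_x (swap i i₀) i)
    simp only [Module.End.mul_apply, swap_apply_left, hxv, map_smul] at this
    exact this.symm
  obtain ⟨q, k, hid, hne, hk⟩ := exists_spectral_idempotent (R.x i₀) (R.g_ne_zero _ hv) hv'
  set P := Polynomial.aeval (R.x i₀) q with hP
  set D := R.x i₀ - algebraMap ℂ (Module.End ℂ V) z with hD
  have hcP : ∀ j, Commute (R.x j) P := fun j => by
    rw [hP, Polynomial.aeval_eq_sum_range]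
    exact Commute.sum_right _ _ _ fun m _ =>
      (Commute.pow_right (R.x_x j i₀) m).smul_right _
  have hcD : Commute D (R.stabSum i₀) :=
    (R.commute_x_stabSum i₀).sub_left (Algebra.commute_algebraMap_left _ _)
  obtain ⟨u, hu⟩ : ∃ u, (R.stabSum i₀ * P) u ≠ 0 := by
    by_contra! h
    refine hne (LinearMap.IsIdempotentElem.eq_zero_of_trace_eq_zero hid ?_)
    rw [← R.trace_stabSum_mul i₀ P hcP, show R.stabSum i₀ * P = 0 from LinearMap.ext h, map_zero]
  have hex : ∃ m, (D ^ m) ((R.stabSum i₀ * P) u) = 0 :=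
    ⟨k, by rw [← Module.End.mul_apply, ← mul_assoc, (hcD.pow_left k).eq, mul_assoc, hk]; simp⟩
  classical
  obtain ⟨m, hm⟩ : ∃ m, Nat.find hex = m + 1 := Nat.exists_eq_succ_of_ne_zero fun h =>
    hu (by simpa [h] using Nat.find_spec hex)
  have hlast := Nat.find_spec hex
  rw [hm, pow_succ', Module.End.mul_apply] at hlast
  refine hreal z ⟨_, Nat.find_min hex (m := m) (by omega), ⟨(D ^ m) (P u), ?_⟩, ?_⟩
  · rw [← Module.End.mul_apply, ← mul_assoc, (hcD.pow_left m).eq]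
    rfl
  · exact sub_eq_zero.1 hlast

end CherRep

end representation

section realForm
open MvPolynomial Equiv

theorem exists_joint_eigenvector {n : ℕ} {V : Type*} [AddCommGroup V] [Module ℂ V]
    [FiniteDimensional ℂ V] [Nontrivial V] (f : Fin n → Module.End ℂ V)
    (hf : ∀ i j, f i * f j = f j * f i) :
    ∃ (μ : Fin n → ℂ) (v : V), v ≠ 0 ∧ ∀ i, f i v = μ i • v := by
  suffices h : ∀ s : Finset (Fin n),
      ∃ μ : Fin n → ℂ, (⨅ i ∈ s, (f i).eigenspace (μ i)) ≠ ⊥ by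
    obtain ⟨μ, hμ⟩ := h Finset.univ
    obtain ⟨v, hv, hv0⟩ := Submodule.exists_mem_ne_zero_of_ne_bot hμ
    exact ⟨μ, v, hv0, fun i => by simpa using Submodule.mem_iInf _ |>.1 hv i⟩
  intro s
  induction s using Finset.induction_on with
  | empty => exact ⟨0, by simp⟩
  | insert j s hj ih =>
    obtain ⟨μ, hμ⟩ := ih
    set W := ⨅ i ∈ s, (f i).eigenspace (μ i) with hW
    have hmaps : ∀ v ∈ W, f j v ∈ W := by
      intro v hv
      simp only [hW, Submodule.mem_iInf, Module.End.mem_eigenspace_iff] at hv ⊢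
      intro i hi
      rw [← Module.End.mul_apply, hf, Module.End.mul_apply, hv i hi, map_smul]
    have : Nontrivial W := Submodule.nontrivial_iff_ne_bot.2 hμ
    obtain ⟨z, hz⟩ := Module.End.exists_eigenvalue ((f j).restrict hmaps)
    obtain ⟨⟨v, hvW⟩, hv⟩ := hz.exists_hasEigenvector
    refine ⟨Function.update μ j z, ?_⟩
    rw [Submodule.ne_bot_iff]
    refine ⟨v, ?_, fun h => hv.2 (Subtype.ext h)⟩
    simp only [hW, Submodule.mem_iInf, Module.End.mem_eigenspace_iff] at hvW ⊢
    intro i hi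
    rcases eq_or_ne i j with rfl | hij
    · rw [Function.update_self]
      exact congrArg Subtype.val hv.apply_eq_smul
    · rw [Function.update_of_ne hij]
      exact hvW i ((Finset.mem_insert.1 hi).resolve_left hij)

namespace CherRep
variable {n : ℕ} {V : Type*} [AddCommGroup V] [Module ℂ V] (R : CherRep n V)

/-- Stability of a real subspace under the generators. -/
def IsStable (U : Submodule ℝ V) : Prop :=
  (∀ i, ∀ u ∈ U, R.x i u ∈ U) ∧ (∀ i, ∀ u ∈ U, R.y i u ∈ U) ∧ ∀ σ, ∀ u ∈ U, R.g σ u ∈ U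

/-- Irreducibility: there are no nontrivial stable complex subspaces. -/
def IsIrred : Prop :=
  ∀ W : Submodule ℂ V, R.IsStable (W.restrictScalars ℝ) → W = ⊥ ∨ W = ⊤

variable {R}

theorem bijective_of_isStable (hR : R.IsIrred) {U : Submodule ℝ V} (hU : R.IsStable U)
    (hbot : U ≠ ⊥) (htop : U ≠ ⊤) :
    Function.Bijective (fun p : U × U => (p.1 : V) + Complex.I • (p.2 : V)) := by
  have hsmul : ∀ (c : ℂ) (v : V), c • v = c.re • v + c.im • Complex.I • v := by
    intro c v
    rw [← Complex.coe_smul c.re, ← Complex.coe_smul c.im, smul_smul, ← add_smul, Complex.re_add_im]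
  have hI : ∀ v : V, Complex.I • Complex.I • v = -v := fun v => by
    rw [smul_smul, Complex.I_mul_I, neg_one_smul]
  let W₁ : Submodule ℂ V :=
    { carrier := {v | v ∈ U ∧ Complex.I • v ∈ U}
      add_mem' := fun {v w} hv hw => ⟨U.add_mem hv.1 hw.1, by
        rw [smul_add]; exact U.add_mem hv.2 hw.2⟩
      zero_mem' := ⟨U.zero_mem, by rw [smul_zero]; exact U.zero_mem⟩
      smul_mem' := fun c v hv => by
        have h : ∀ w, w ∈ U → Complex.I • w ∈ U → c • w ∈ U := fun w h1 h2 => by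
          rw [hsmul]; exact U.add_mem (U.smul_mem _ h1) (U.smul_mem _ h2)
        refine ⟨h v hv.1 hv.2, ?_⟩
        rw [smul_comm]
        exact h _ hv.2 (by rw [hI]; exact U.neg_mem hv.1) }
  let W₂ : Submodule ℂ V :=
    { carrier := {v | ∃ u ∈ U, ∃ u' ∈ U, u + Complex.I • u' = v}
      add_mem' := by
        rintro _ _ ⟨u, hu, u', hu', rfl⟩ ⟨w, hw, w', hw', rfl⟩
        exact ⟨u + w, U.add_mem hu hw, u' + w', U.add_mem hu' hw', by rw [smul_add]; abel⟩
      zero_mem' := ⟨0, U.zero_mem, 0, U.zero_mem, by simp⟩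
      smul_mem' := by
        rintro c _ ⟨u, hu, u', hu', rfl⟩
        refine ⟨c.re • u - c.im • u', U.sub_mem (U.smul_mem _ hu) (U.smul_mem _ hu'),
          c.im • u + c.re • u', U.add_mem (U.smul_mem _ hu) (U.smul_mem _ hu'), ?_⟩
        rw [hsmul c (u + Complex.I • u')]
        simp only [smul_add, hI, smul_neg, smul_comm _ Complex.I]
        abel }
  have hW₁ : W₁ = ⊥ := by
    refine (hR W₁ ⟨fun i v hv => ?_, fun i v hv => ?_, fun σ v hv => ?_⟩).resolve_right
      fun h => htop (eq_top_iff.2 fun v _ => ?_)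
    · exact ⟨hU.1 i v hv.1, by rw [← map_smul]; exact hU.1 i _ hv.2⟩
    · exact ⟨hU.2.1 i v hv.1, by rw [← map_smul]; exact hU.2.1 i _ hv.2⟩
    · exact ⟨hU.2.2 σ v hv.1, by rw [← map_smul]; exact hU.2.2 σ _ hv.2⟩
    · exact (h ▸ Submodule.mem_top : v ∈ W₁).1
  have hW₂ : W₂ = ⊤ := by
    refine (hR W₂ ⟨?_, ?_, ?_⟩).resolve_left fun h => hbot ?_
    · rintro i _ ⟨u, hu, u', hu', rfl⟩
      exact ⟨_, hU.1 i u hu, _, hU.1 i u' hu', by rw [map_add, map_smul]⟩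
    · rintro i _ ⟨u, hu, u', hu', rfl⟩
      exact ⟨_, hU.2.1 i u hu, _, hU.2.1 i u' hu', by rw [map_add, map_smul]⟩
    · rintro σ _ ⟨u, hu, u', hu', rfl⟩
      exact ⟨_, hU.2.2 σ u hu, _, hU.2.2 σ u' hu', by rw [map_add, map_smul]⟩
    · rw [Submodule.eq_bot_iff]
      intro u hu
      have : u ∈ W₂ := ⟨u, hu, 0, U.zero_mem, by simp⟩
      rwa [h, Submodule.mem_bot] at this
  constructor
  · rintro ⟨u, u'⟩ ⟨w, w'⟩ h
    have h1 : (u : V) - w = Complex.I • ((w' : V) - u') := by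
      rw [smul_sub, sub_eq_sub_iff_add_eq_add, add_comm _ (w : V)]
      exact h
    have h2 : (w' : V) - u' ∈ W₁ := ⟨U.sub_mem w'.2 u'.2, h1 ▸ U.sub_mem u.2 w.2⟩
    rw [hW₁, Submodule.mem_bot] at h2
    rw [h2, smul_zero] at h1
    exact Prod.ext (Subtype.ext (sub_eq_zero.1 h1)) (Subtype.ext (sub_eq_zero.1 h2).symm)
  · intro v
    obtain ⟨u, hu, u', hu', h⟩ := (hW₂ ▸ Submodule.mem_top : v ∈ W₂)
    exact ⟨(⟨u, hu⟩, ⟨u', hu'⟩), h⟩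

variable (R)

open scoped IsMulCommutative in
theorem exists_polyOp : ∃ F : MvPolynomial (Fin n) ℝ →ₐ[ℝ] Module.End ℂ V, ∀ i, F (X i) = R.x i := by
  have := Algebra.isMulCommutative_adjoin ℝ (s := Set.range R.x) (by
    rintro _ ⟨i, rfl⟩ _ ⟨j, rfl⟩
    exact R.x_x i j)
  refine ⟨(Algebra.adjoin ℝ (Set.range R.x)).val.comp
    (aeval fun i => ⟨R.x i, Algebra.subset_adjoin ⟨i, rfl⟩⟩), fun i => ?_⟩
  simp

/-- The action of real polynomials in the `x i`. -/
noncomputable def polyOp : MvPolynomial (Fin n) ℝ →ₐ[ℝ] Module.End ℂ V :=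
  R.exists_polyOp.choose

@[simp] theorem polyOp_X (i : Fin n) : R.polyOp (X i) = R.x i :=
  R.exists_polyOp.choose_spec i

theorem g_mul_polyOp (σ : Perm (Fin n)) (p : MvPolynomial (Fin n) ℝ) :
    R.g σ * R.polyOp p = R.polyOp (rename σ p) * R.g σ := by
  induction p using MvPolynomial.induction_on with
  | C a =>
    rw [rename_C, ← algebraMap_eq, AlgHom.commutes]
    exact (Algebra.commutes a (R.g σ)).symm
  | add p q hp hq => simp only [map_add, mul_add, add_mul, hp, hq]
  | mul_X p i hp =>
    rw [map_mul, map_mul, map_mul, ← mul_assoc, hp, mul_assoc, polyOp_X, R.g_x, rename_X, polyOp_X,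
      mul_assoc]

theorem y_mul_x (i k : Fin n) : R.y i * R.x k = R.x k * R.y i +
    ∑ j, R.polyOp (divDiff i j (X k)) * R.g (swap i j) := by
  rcases eq_or_ne k i with rfl | hki
  · have h : ∑ j, R.polyOp (divDiff k j (X k)) * R.g (swap k j) =
        ∑ j ∈ Finset.univ.erase k, R.g (swap j k) := by
      rw [← Finset.add_sum_erase _ _ (Finset.mem_univ k), divDiff_self, map_zero, zero_mul,
        zero_add]
      refine Finset.sum_congr rfl fun j hj => ?_
      rw [divDiff_X_self (Finset.ne_of_mem_erase hj).symm, map_one, one_mul, swap_comm]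
    rw [h, ← neg_neg (∑ j ∈ _, _), ← R.x_y_same k]
    abel
  · rw [Finset.sum_eq_single k, divDiff_X_right hki.symm, map_neg, map_one, neg_one_mul,
      swap_comm, ← R.x_y k i hki]
    · abel
    · intro j _ hj
      rw [divDiff_X_of_ne hki hj.symm, map_zero, zero_mul]
    · simp

theorem y_mul_polyOp (i : Fin n) (p : MvPolynomial (Fin n) ℝ) :
    R.y i * R.polyOp p = R.polyOp p * R.y i +
      ∑ j, R.polyOp (divDiff i j p) * R.g (swap i j) := by
  induction p using MvPolynomial.induction_on with
  | C a =>
    have h : ∀ j, divDiff i j (C a : MvPolynomial (Fin n) ℝ) = 0 := fun j =>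
      divDiff_of_isSymmetric i j fun σ => rename_C _ _
    simp only [h, map_zero, zero_mul, Finset.sum_const_zero, add_zero]
    rw [← algebraMap_eq, AlgHom.commutes]
    exact (Algebra.commutes a (R.y i)).symm
  | add p q hp hq =>
    simp only [map_add, mul_add, add_mul, hp, hq, Finset.sum_add_distrib]
    abel
  | mul_X p k hp =>
    have h : ∀ j, R.polyOp (divDiff i j (p * X k)) * R.g (swap i j) =
        R.polyOp (divDiff i j p) * R.g (swap i j) * R.x k +
          R.polyOp p * (R.polyOp (divDiff i j (X k)) * R.g (swap i j)) := by
      intro j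
      rw [divDiff_mul, map_add, map_mul, map_mul, add_mul, mul_assoc, ← R.g_mul_polyOp, polyOp_X,
        mul_assoc, mul_assoc]
    simp only [h, Finset.sum_add_distrib]
    rw [map_mul, polyOp_X, ← mul_assoc, hp, add_mul, mul_assoc, R.y_mul_x, mul_add,
      Finset.sum_mul, Finset.mul_sum, mul_assoc]
    abel

theorem commute_y_polyOp (i : Fin n) {c : MvPolynomial (Fin n) ℝ} (hc : c.IsSymmetric) :
    R.y i * R.polyOp c = R.polyOp c * R.y i := by
  rw [y_mul_polyOp, Finset.sum_eq_zero fun j _ => ?_, add_zero]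
  rw [divDiff_of_isSymmetric i j hc, map_zero, zero_mul]

variable {R}

theorem polyOp_apply_of_eigenvector {a : Fin n → ℝ} {v : V} (hv : ∀ i, R.x i v = a i • v)
    (p : MvPolynomial (Fin n) ℝ) : R.polyOp p v = eval a p • v := by
  induction p using MvPolynomial.induction_on with
  | C r =>
    rw [← algebraMap_eq, AlgHom.commutes, algebraMap_eq, eval_C, Algebra.algebraMap_eq_smul_one]
    rfl
  | add p q hp hq => rw [map_add, LinearMap.add_apply, hp, hq, map_add, add_smul]
  | mul_X p i hp =>
    rw [map_mul, Module.End.mul_apply, polyOp_X, hv, LinearMap.map_smul_of_tower, hp, map_mul, eval_X, smul_smul,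
      mul_comm]

theorem polyOp_isSymmetric (hR : R.IsIrred) {a : Fin n → ℝ} {v : V} (hv0 : v ≠ 0)
    (hv : ∀ i, R.x i v = a i • v) {c : MvPolynomial (Fin n) ℝ} (hc : c.IsSymmetric) (u : V) :
    R.polyOp c u = eval a c • u := by
  let W : Submodule ℂ V := LinearMap.ker (R.polyOp c - algebraMap ℝ (Module.End ℂ V) (eval a c))
  have hmem : ∀ u, u ∈ W ↔ R.polyOp c u = eval a c • u := fun u => by
    rw [LinearMap.mem_ker, LinearMap.sub_apply, sub_eq_zero, Algebra.algebraMap_eq_smul_one]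
    rfl
  have hstab : ∀ f : Module.End ℂ V, f * R.polyOp c = R.polyOp c * f → ∀ u ∈ W, f u ∈ W := by
    intro f hf u hu
    rw [hmem] at hu ⊢
    rw [← Module.End.mul_apply, ← hf, Module.End.mul_apply, hu, LinearMap.map_smul_of_tower]
  have hW : W = ⊤ := by
    refine (hR W ⟨fun i => hstab _ ?_, fun i => hstab _ (R.commute_y_polyOp i hc),
      fun σ => hstab _ ?_⟩).resolve_left fun h => hv0 ?_
    · rw [← polyOp_X, ← map_mul, ← map_mul, mul_comm]
    · rw [R.g_mul_polyOp, hc]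
    · rw [← Submodule.mem_bot ℂ, ← h, hmem]
      exact polyOp_apply_of_eigenvector hv c
  exact (hmem u).1 (hW ▸ Submodule.mem_top)

variable (R)

/-- The action of real words in the Cherednik generators. -/
noncomputable def freeOp : FreeAlgebra ℝ (CherGen n) →ₐ[ℝ] Module.End ℂ V :=
  FreeAlgebra.lift ℝ fun
    | .x i => R.x i
    | .y i => R.y i
    | .g σ => R.g σ

/-- The map from the polynomial model to a representation determined by a vector. -/
noncomputable def fromModel (v : V) : PolyModel n →ₗ[ℝ] V where
  toFun m := ∑ w, R.polyOp (m w) (R.g w v)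
  map_add' m m' := by simp [Finset.sum_add_distrib]
  map_smul' c m := by simp [Finset.smul_sum]

theorem fromModel_apply (v : V) (m : PolyModel n) :
    R.fromModel v m = ∑ w, R.polyOp (m w) (R.g w v) := rfl

theorem fromModel_modelG (v : V) (σ : Perm (Fin n)) (m : PolyModel n) :
    R.fromModel v (modelG σ m) = R.g σ (R.fromModel v m) := by
  simp only [fromModel_apply, map_sum]
  rw [← Equiv.sum_comp (Equiv.mulLeft σ)]
  refine Finset.sum_congr rfl fun w _ => ?_
  rw [← Module.End.mul_apply (R.g σ), R.g_mul_polyOp, Module.End.mul_apply, R.g_mul_g_apply]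
  simp [modelG]

theorem fromModel_modelY {lam : Fin n → ℝ} {v : V} (hv : ∀ i, R.y i v = lam i • v) (i : Fin n)
    (m : PolyModel n) : R.fromModel v (modelY lam i m) = R.y i (R.fromModel v m) := by
  have h1 : ∀ w, R.y i (R.polyOp (m w) (R.g w v)) = lam (w⁻¹ i) • R.polyOp (m w) (R.g w v) +
      ∑ j, R.polyOp (divDiff i j (m w)) (R.g (swap i j * w) v) := by
    intro w
    have h2 : R.y i (R.g w v) = lam (w⁻¹ i) • R.g w v := by
      have h := congrArg (fun F => F v) (R.g_y w (w⁻¹ i))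
      rw [show w (w⁻¹ i) = i by simp] at h
      simp only [Module.End.mul_apply, hv, LinearMap.map_smul_of_tower] at h
      exact h.symm
    rw [← Module.End.mul_apply, R.y_mul_polyOp, LinearMap.add_apply, Module.End.mul_apply, h2,
      LinearMap.map_smul_of_tower, LinearMap.sum_apply]
    simp only [Module.End.mul_apply, R.g_mul_g_apply]
  have h3 : ∀ j, ∑ w, R.polyOp (divDiff i j (m (swap i j * w))) (R.g w v) =
      ∑ w, R.polyOp (divDiff i j (m w)) (R.g (swap i j * w) v) := by
    intro j
    rw [← Equiv.sum_comp (Equiv.mulLeft (swap i j))]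
    simp
  simp only [fromModel_apply, map_sum, h1, Finset.sum_add_distrib]
  rw [Finset.sum_comm (s := Finset.univ (α := Perm (Fin n))), ← Finset.sum_congr rfl fun j _ => h3 j,
    Finset.sum_comm, ← Finset.sum_add_distrib]
  refine Finset.sum_congr rfl fun w _ => ?_
  simp [modelY, LinearMap.sum_apply]

theorem fromModel_modelRep {lam : Fin n → ℝ} {v : V} (hv : ∀ i, R.y i v = lam i • v)
    (f : FreeAlgebra ℝ (CherGen n)) :
    ∀ m, R.fromModel v (modelRep lam f m) = R.freeOp f (R.fromModel v m) := by
  induction f using FreeAlgebra.induction with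
  | grade0 r =>
    intro m
    rw [AlgHom.commutes, AlgHom.commutes, Algebra.algebraMap_eq_smul_one,
      Algebra.algebraMap_eq_smul_one]
    exact map_smul _ r m
  | grade1 z =>
    intro m
    rw [modelRep, freeOp, FreeAlgebra.lift_ι_apply, FreeAlgebra.lift_ι_apply]
    cases z with
    | x i => simp [fromModel_apply, modelX]
    | y i => exact R.fromModel_modelY hv i m
    | g σ => exact R.fromModel_modelG v σ m
  | mul f g hf hg => intro m; rw [map_mul, map_mul, Module.End.mul_apply, hf, hg]; rfl
  | add f g hf hg =>
    intro m
    rw [map_add, map_add, LinearMap.add_apply, map_add, hf, hg, LinearMap.add_apply]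

end CherRep

end realForm

section mainArgument
open MvPolynomial Equiv
namespace CherRep
variable {n : ℕ} {V : Type*} [AddCommGroup V] [Module ℂ V] {R : CherRep n V}

theorem isStable_of_freeOp {U : Submodule ℝ V} (h : ∀ f, ∀ u ∈ U, R.freeOp f u ∈ U) :
    R.IsStable U :=
  ⟨fun i u hu => by simpa [freeOp] using h (FreeAlgebra.ι ℝ (.x i)) u hu,
    fun i u hu => by simpa [freeOp] using h (FreeAlgebra.ι ℝ (.y i)) u hu,
    fun σ u hu => by simpa [freeOp] using h (FreeAlgebra.ι ℝ (.g σ)) u hu⟩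

theorem freeOp_freeSymm {v : V} (hv : ∀ σ, R.g σ v = v) : R.freeOp (freeSymm n) v = v := by
  have hfac : (n.factorial : ℝ) ≠ 0 := Nat.cast_ne_zero.2 n.factorial_ne_zero
  simp only [freeOp, freeSymm, map_smul, map_sum, FreeAlgebra.lift_ι_apply, LinearMap.smul_apply,
    LinearMap.sum_apply, hv, Finset.sum_const, Finset.card_univ, Fintype.card_perm,
    Fintype.card_fin]
  rw [← Nat.cast_smul_eq_nsmul ℝ, inv_smul_smul₀ hfac]

theorem fromModel_isSymmetric_smul (v : V) {a : Fin n → ℝ}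
    (ha : ∀ c : MvPolynomial (Fin n) ℝ, c.IsSymmetric → ∀ u : V, R.polyOp c u = eval a c • u)
    {c : MvPolynomial (Fin n) ℝ} (hc : c.IsSymmetric) (m : PolyModel n) :
    R.fromModel v (c • m) = eval a c • R.fromModel v m := by
  rw [← ha c hc]
  simp [fromModel_apply]

/-- An irreducible representation in which the `x i` and the `y i` have only real eigenvalues
contains a nontrivial stable real subspace. -/
theorem exists_isStable [FiniteDimensional ℂ V] [Nontrivial V] (hR : R.IsIrred)
    (hx : ∀ i (z : ℂ) (v : V), v ≠ 0 → R.x i v = z • v → z.im = 0)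
    (hy : ∀ i (z : ℂ) (v : V), v ≠ 0 → R.y i v = z • v → z.im = 0) :
    ∃ U : Submodule ℝ V, R.IsStable U ∧ U ≠ ⊥ ∧ U ≠ ⊤ := by
  by_contra! hcon
  have htop : ∀ U : Submodule ℝ V, R.IsStable U → ∀ u ∈ U, u ≠ 0 → U = ⊤ := fun U hU u hu hu0 =>
    hcon U hU fun h => hu0 ((Submodule.eq_bot_iff U).1 h u hu)
  have hjoint : ∀ F : Fin n → Module.End ℂ V, (∀ i j, F i * F j = F j * F i) →
      (∀ i (z : ℂ) (v : V), v ≠ 0 → F i v = z • v → z.im = 0) →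
      ∃ (a : Fin n → ℝ) (v : V), v ≠ 0 ∧ ∀ i, F i v = a i • v := by
    intro F hF hreal
    obtain ⟨μ, v, hv0, hv⟩ := exists_joint_eigenvector F hF
    refine ⟨fun i => (μ i).re, v, hv0, fun i => ?_⟩
    rw [hv, ← Complex.coe_smul]
    congr 1
    exact Complex.ext (by simp) (by simpa using hreal i (μ i) v hv0 (hv i))
  obtain ⟨a, u₀, hu₀, hau₀⟩ := hjoint R.x R.x_x hx
  obtain ⟨lam, v₀, hv₀, hlam⟩ := hjoint R.y R.y_y hy
  obtain ⟨v, hv, hinv⟩ := R.exists_invariant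
  have hsymm : ∀ c : MvPolynomial (Fin n) ℝ, c.IsSymmetric → ∀ u : V,
      R.polyOp c u = eval a c • u := fun c hc => polyOp_isSymmetric hR hu₀ hau₀ hc
  set φ := R.fromModel v₀ with hφ
  have hφop := R.fromModel_modelRep hlam
  have hφtop : LinearMap.range φ = ⊤ := by
    refine htop _ (isStable_of_freeOp ?_) (φ (Pi.single 1 1)) ⟨_, rfl⟩ ?_
    · rintro f _ ⟨m, rfl⟩
      exact ⟨_, hφop f m⟩
    · rw [hφ, fromModel_apply, Finset.sum_eq_single 1]
      · simpa using hv₀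
      · intro w _ hw
        rw [Pi.single_eq_of_ne hw, map_zero, LinearMap.zero_apply]
      · simp
  obtain ⟨f, hf⟩ : ∃ f, R.freeOp f v = Complex.I • v := by
    let orb : FreeAlgebra ℝ (CherGen n) →ₗ[ℝ] V :=
      { toFun := fun f => R.freeOp f v
        map_add' := fun f g => by rw [map_add, LinearMap.add_apply]
        map_smul' := fun c f => by rw [map_smul, LinearMap.smul_apply, RingHom.id_apply] }
    have horb : LinearMap.range orb = ⊤ := by
      refine htop _ (isStable_of_freeOp ?_) v ⟨1, by simp [orb]⟩ hv
      rintro f _ ⟨h, rfl⟩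
      exact ⟨f * h, by simp [orb]⟩
    exact (horb ▸ Submodule.mem_top : Complex.I • v ∈ LinearMap.range orb)
  obtain ⟨b, hb⟩ := exists_symmetric_spanning_family n
  obtain ⟨N, hNsymm, hN, hdet⟩ := exists_modelRep_matrix lam f hb
  set T := R.freeOp (freeSymm n * f) with hT
  have hTv : T v = Complex.I • v := by
    rw [hT, map_mul, Module.End.mul_apply, hf, map_smul, freeOp_freeSymm hinv]
  set N₀ := N.map (eval a) with hN₀
  let ψ : (Perm (Fin n) → ℝ) →ₗ[ℝ] V := Fintype.linearCombination ℝ fun k => φ (orbitMap (b k))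
  have hψ : ∀ d, ψ d = ∑ k, d k • φ (orbitMap (b k)) := fun d => rfl
  have hTψ : ∀ d, T (ψ d) = ψ (N₀.mulVec d) := by
    intro d
    have h : ∀ k, T (φ (orbitMap (b k))) = ∑ l, N₀ l k • φ (orbitMap (b l)) := by
      intro k
      rw [hT, ← hφop, hN, map_sum]
      exact Finset.sum_congr rfl fun l _ => fromModel_isSymmetric_smul v₀ hsymm (hNsymm l k) _
    simp only [hψ, map_sum, LinearMap.map_smul_of_tower, h, Finset.smul_sum, smul_smul,
      Matrix.mulVec, dotProduct, Finset.sum_smul]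
    rw [Finset.sum_comm]
    simp only [mul_comm]
  obtain ⟨d, hd⟩ : ∃ d, ψ d = v := by
    obtain ⟨m, hm⟩ : v ∈ LinearMap.range φ := hφtop ▸ Submodule.mem_top
    obtain ⟨p, hp⟩ := modelRep_freeSymm_eq_orbitMap lam m
    obtain ⟨c, hc, hpc⟩ := hb p
    refine ⟨fun k => eval a (c k), ?_⟩
    rw [← freeOp_freeSymm hinv, ← hm, ← hφop, hp, hpc, hψ]
    have : orbitMap (∑ k, c k * b k) = ∑ k, c k • orbitMap (b k) := by
      ext1 w
      simp [orbitMap, Finset.sum_apply, hc _ w]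
    rw [this, map_sum]
    exact Finset.sum_congr rfl fun k _ => (fromModel_isSymmetric_smul v₀ hsymm (hc k) _).symm
  set M := 1 + N₀ * N₀ with hM
  have hunit : IsUnit M.det := isUnit_iff_ne_zero.2 (by linarith [hdet a])
  have hMψ : ∀ e, ψ e + T (T (ψ e)) = ψ (M.mulVec e) := by
    intro e
    rw [hTψ, hTψ, ← map_add, Matrix.mulVec_mulVec, hM, Matrix.add_mulVec, Matrix.one_mulVec]
  let L : LinearMap.range ψ →ₗ[ℝ] LinearMap.range ψ :=
    LinearMap.restrict (1 + (T * T).restrictScalars ℝ) (by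
      rintro _ ⟨e, rfl⟩
      exact ⟨_, (hMψ e).symm⟩)
  have hLsurj : Function.Surjective L := by
    rintro ⟨_, e, rfl⟩
    refine ⟨⟨ψ (M⁻¹.mulVec e), _, rfl⟩, Subtype.ext ?_⟩
    refine (hMψ _).trans ?_
    rw [Matrix.mulVec_mulVec, Matrix.mul_nonsing_inv _ hunit, Matrix.one_mulVec]
  have hLinj : Function.Injective L := LinearMap.injective_iff_surjective.2 hLsurj
  have hLv : L ⟨v, d, hd⟩ = 0 := Subtype.ext <| by
    change v + T (T v) = 0
    rw [hTv, map_smul, hTv, smul_smul, Complex.I_mul_I, neg_one_smul, add_neg_cancel]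
  exact hv (congrArg Subtype.val (hLinj (hLv.trans (map_zero L).symm)))

end CherRep

/-- The representation underlying a module over the rational Cherednik algebra. -/
noncomputable def cherRepOfModule (n : ℕ) (V : Type*) [AddCommGroup V] [Module ℂ V]
    [Module (CherednikAlgebra n) V] [IsScalarTower ℂ (CherednikAlgebra n) V] : CherRep n V := by
  let A : CherednikAlgebra n →ₐ[ℂ] Module.End ℂ V := Algebra.lsmul ℂ ℂ V
  have hrel : ∀ {p q}, CherRel n p q →
      RingQuot.mkAlgHom ℂ (CherRel n) p = RingQuot.mkAlgHom ℂ (CherRel n) q :=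
    fun h => RingQuot.mkAlgHom_rel ℂ h
  refine
    { x := fun i => A (cherX n i)
      y := fun i => A (cherY n i)
      g := { toFun := fun σ => A (cherG n σ), map_one' := ?_, map_mul' := fun σ τ => ?_ }
      g_x := fun σ i => ?_
      g_y := fun σ i => ?_
      x_x := fun i j => ?_
      y_y := fun i j => ?_
      x_y := fun i j hij => ?_
      x_y_same := fun k => ?_ }
  · rw [cherG, hrel .g_one, map_one, map_one]
  · rw [← map_mul, cherG, cherG, cherG, ← map_mul, hrel (.g_mul σ τ)]
  · change A _ * A _ = A _ * A _
    rw [← map_mul, ← map_mul, cherG, cherX, cherX, ← map_mul, ← map_mul, hrel (.g_x σ i)]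
  · change A _ * A _ = A _ * A _
    rw [← map_mul, ← map_mul, cherG, cherY, cherY, ← map_mul, ← map_mul, hrel (.g_y σ i)]
  · rw [← map_mul, ← map_mul, cherX, cherX, ← map_mul, ← map_mul, hrel (.x_x i j)]
  · rw [← map_mul, ← map_mul, cherY, cherY, ← map_mul, ← map_mul, hrel (.y_y i j)]
  · change A _ * A _ - A _ * A _ = A _
    rw [← map_mul, ← map_mul, ← map_sub, cherX, cherY, cherG, ← map_mul, ← map_mul, ← map_sub,
      hrel (.x_y i j hij)]
  · change A _ * A _ - A _ * A _ = -∑ i ∈ _, A _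
    rw [← map_mul, ← map_mul, ← map_sub, cherX, cherY, ← map_mul, ← map_mul, ← map_sub,
      hrel (.x_y_same k)]
    simp only [map_neg, map_sum, cherG]

section cherednikModule
variable {n : ℕ} {V : Type*} [AddCommGroup V] [Module ℂ V]
    [Module (CherednikAlgebra n) V] [IsScalarTower ℂ (CherednikAlgebra n) V]

theorem isIrred_cherRepOfModule (hirr : IsSimpleModule (CherednikAlgebra n) V) :
    (cherRepOfModule n V).IsIrred := by
  intro W hW
  have hstab : ∀ p : FreeAlgebra ℂ (CherGen n), ∀ u ∈ W,
      RingQuot.mkAlgHom ℂ (CherRel n) p • u ∈ W := by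
    intro p
    induction p using FreeAlgebra.induction with
    | grade0 c =>
      intro u hu
      rw [AlgHom.commutes, algebraMap_smul]
      exact W.smul_mem c hu
    | grade1 z =>
      cases z with
      | x i => exact hW.1 i
      | y i => exact hW.2.1 i
      | g σ => exact hW.2.2 σ
    | mul p q hp hq => intro u hu; rw [map_mul, mul_smul]; exact hp _ (hq _ hu)
    | add p q hp hq => intro u hu; rw [map_add, add_smul]; exact W.add_mem (hp _ hu) (hq _ hu)
  let W' : Submodule (CherednikAlgebra n) V :=
    { W with
      smul_mem' := fun h u hu => by
        obtain ⟨p, rfl⟩ := RingQuot.mkAlgHom_surjective ℂ (CherRel n) h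
        exact hstab p u hu }
  refine (eq_bot_or_eq_top W').imp (fun h => ?_) fun h => ?_
  · exact (Submodule.eq_bot_iff W).2 fun u hu => (Submodule.eq_bot_iff W').1 h u hu
  · exact eq_top_iff.2 fun u _ => (h ▸ Submodule.mem_top : u ∈ W')

theorem cherE_smul (hn : 0 < n) (w : V) : cherE n hn • w =
    (((n - 1).factorial : ℂ)⁻¹) • (cherRepOfModule n V).stabSum ⟨0, hn⟩ w := by
  rw [cherE, smul_assoc, Finset.sum_smul, CherRep.stabSum, LinearMap.sum_apply]
  rfl

theorem exists_eq_cherE_smul (hn : 0 < n) {v : V}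
    (h : ∃ w, v = (cherRepOfModule n V).stabSum ⟨0, hn⟩ w) : ∃ w : V, v = cherE n hn • w := by
  obtain ⟨w, rfl⟩ := h
  have hfac : ((n - 1).factorial : ℂ) ≠ 0 := Nat.cast_ne_zero.2 (Nat.factorial_ne_zero _)
  exact ⟨((n - 1).factorial : ℂ) • w, by rw [cherE_smul, map_smul, inv_smul_smul₀ hfac]⟩

end cherednikModule
end mainArgument

end CherednikReal

/-- **Main Theorem.** Let `V` be a finite-dimensional irreducible module over the
rational Cherednik algebra `H_{0,1}(S_n)`, `n ≥ 1`. If the operators induced by `x₁` and `y₁` on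
`ēV` have only real eigenvalues (i.e. every eigenvalue of `x₁`, resp. `y₁`, with eigenvector in
`ēV` is real), then `V` is the complexification of a real representation: there is an
`ℝ`-subspace `U ⊆ V`, stable under all `x_i`, `y_i` and all the group elements of `S_n`, such
that the natural map `ℂ ⊗_ℝ U → V`, `(u₁, u₂) ↦ u₁ + i·u₂`, is bijective. -/
theorem cherednik_real_representation (n : ℕ) (hn : 0 < n)
    (V : Type) [AddCommGroup V] [Module ℂ V]
    [Module (CherednikAlgebra n) V] [IsScalarTower ℂ (CherednikAlgebra n) V]
    [FiniteDimensional ℂ V]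
    (hirr : IsSimpleModule (CherednikAlgebra n) V)
    (hx1 : ∀ z : ℂ, (∃ v : V, v ≠ 0 ∧ (∃ w : V, v = cherE n hn • w) ∧
      cherX n ⟨0, hn⟩ • v = z • v) → z.im = 0)
    (hy1 : ∀ z : ℂ, (∃ v : V, v ≠ 0 ∧ (∃ w : V, v = cherE n hn • w) ∧
      cherY n ⟨0, hn⟩ • v = z • v) → z.im = 0) :
    ∃ U : Submodule ℝ V,
      (∀ i : Fin n, ∀ u ∈ U, cherX n i • u ∈ U) ∧
      (∀ i : Fin n, ∀ u ∈ U, cherY n i • u ∈ U) ∧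
      (∀ σ : Equiv.Perm (Fin n), ∀ u ∈ U, cherG n σ • u ∈ U) ∧
      Function.Bijective (fun p : U × U => (p.1 : V) + Complex.I • (p.2 : V)) := by
  have := IsSimpleModule.nontrivial (CherednikAlgebra n) V
  set R := CherednikReal.cherRepOfModule n V with hRdef
  have hR : R.IsIrred := CherednikReal.isIrred_cherRepOfModule hirr
  have hx : ∀ i (z : ℂ) (v : V), v ≠ 0 → R.x i v = z • v → z.im = 0 := fun i z v =>
    R.im_eq_zero_of_x_apply_eq ⟨0, hn⟩ (fun z ⟨v, hv, hw, hxv⟩ =>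
      hx1 z ⟨v, hv, CherednikReal.exists_eq_cherE_smul hn hw, hxv⟩) i
  have hy : ∀ i (z : ℂ) (v : V), v ≠ 0 → R.y i v = z • v → z.im = 0 := fun i z v =>
    R.fourier.im_eq_zero_of_x_apply_eq ⟨0, hn⟩ (fun z ⟨v, hv, hw, hyv⟩ =>
      hy1 z ⟨v, hv, CherednikReal.exists_eq_cherE_smul hn hw, hyv⟩) i
  obtain ⟨U, hU, hbot, htop⟩ := CherednikReal.CherRep.exists_isStable hR hx hy
  exact ⟨U, hU.1, hU.2.1, hU.2.2, CherednikReal.CherRep.bijective_of_isStable hR hU hbot htop⟩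
end

section
/- Let λ₁,…,λₙ be distinct real numbers and let α = (α₁,…,αₙ) ∈ ℂⁿ. Let Z be the n×n complex matrix with diagonal entries Z_{ii} = α_i and off-diagonal entries Z_{ij} = (λ_i − λ_j)⁻¹ for i ≠ j. If Z has only real eigenvalues, then α ∈ ℝⁿ, i.e., every α_i is real. -/
namespace CalogeroMoser

lemma exists_joint_eigenvector {ι K V : Type*} [Fintype ι] [Field K] [IsAlgClosed K]
    [AddCommGroup V] [Module K V] [FiniteDimensional K V] [Nontrivial V] (y : ι → Module.End K V)
    (hy : ∀ i j, Commute (y i) (y j)) : ∃ (w : ι → K) (v : V), v ≠ 0 ∧ ∀ i, y i v = w i • v := by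
  classical
  suffices h : ∀ s : Finset ι, ∃ (w : ι → K) (v : V), v ≠ 0 ∧ ∀ i ∈ s, y i v = w i • v by
    simpa using h Finset.univ
  intro s
  induction s using Finset.induction_on with
  | empty => simpa using exists_ne (0 : V)
  | insert a s ha ih =>
    obtain ⟨w, v, hv, hw⟩ := ih
    let p : Submodule K V := ⨅ i ∈ s, Module.End.eigenspace (y i) (w i)
    have hp : ∀ u, u ∈ p ↔ ∀ i ∈ s, y i u = w i • u := fun u => by simp [p]
    have hmaps : ∀ u ∈ p, y a u ∈ p := by
      intro u hu
      rw [hp] at hu ⊢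
      intro i hi
      rw [← Module.End.mul_apply, (hy i a).eq, Module.End.mul_apply, hu i hi, map_smul]
    have : Nontrivial p := ⟨⟨⟨v, (hp v).2 hw⟩, 0, fun h => hv congr(($h : V))⟩⟩
    obtain ⟨c, hc⟩ := Module.End.exists_eigenvalue ((y a).restrict hmaps)
    obtain ⟨u, hu⟩ := hc.exists_hasEigenvector
    refine ⟨Function.update w a c, u, fun h => hu.2 (Subtype.ext h), fun i hi => ?_⟩
    rcases Finset.mem_insert.1 hi with rfl | hi
    · simpa using congr(($(hu.apply_eq_smul) : V))
    · rw [Function.update_of_ne (show i ≠ a from fun h => ha (h ▸ hi))]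
      exact (hp u).1 u.2 i hi

lemma isRoot_charpoly_of_sum_pow_eq_trace {ι K : Type*} [Fintype ι] [DecidableEq ι] [Field K]
    [CharZero K] (Z : Matrix ι ι K) (w : ι → K) (h : ∀ k : ℕ, ∑ i, w i ^ k = (Z ^ k).trace)
    (i : ι) : Z.charpoly.IsRoot (w i) := by
  classical
  have hp : ∀ p : Polynomial K, ∑ j, p.eval (w j) = (Polynomial.aeval Z p).trace := by
    intro p
    induction p using Polynomial.induction_on' with
    | add p q hp hq => simp [Finset.sum_add_distrib, hp, hq]
    | monomial k a =>
      simp [Polynomial.aeval_monomial, ← Finset.mul_sum, h, Algebra.algebraMap_eq_smul_one]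
  let q : Polynomial K := ∏ b ∈ (Finset.univ.image w).erase (w i), (Polynomial.X - Polynomial.C b)
  have hq : q.eval (w i) ≠ 0 := by
    simp only [q, Polynomial.eval_prod, Polynomial.eval_sub, Polynomial.eval_X, Polynomial.eval_C]
    exact Finset.prod_ne_zero_iff.2 fun b hb => sub_ne_zero.2 (Finset.ne_of_mem_erase hb).symm
  have hq' : ∀ j, w j ≠ w i → q.eval (w j) = 0 := fun j hj => by
    simp only [q, Polynomial.eval_prod, Polynomial.eval_sub, Polynomial.eval_X, Polynomial.eval_C]
    exact Finset.prod_eq_zero (Finset.mem_erase.2 ⟨hj, by simp⟩) (sub_self _)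
  have hs := hp (Z.charpoly * q)
  rw [map_mul, Matrix.aeval_self_charpoly, zero_mul, Matrix.trace_zero,
    ← Finset.sum_filter_add_sum_filter_not _ (fun j => w j = w i),
    Finset.sum_congr rfl (g := fun _ => (Z.charpoly * q).eval (w i))
      fun j hj => by rw [(Finset.mem_filter.1 hj).2],
    Finset.sum_eq_zero (s := {j | ¬w j = w i}) fun j hj => by
      rw [Polynomial.eval_mul, hq' j (Finset.mem_filter.1 hj).2, mul_zero],
    Finset.sum_const, add_zero, nsmul_eq_mul, Polynomial.eval_mul] at hs
  have hcard : (({j | w j = w i} : Finset ι).card : K) ≠ 0 :=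
    Nat.cast_ne_zero.2 (Finset.card_ne_zero_of_mem (a := i) (by simp))
  simpa [hcard, hq] using hs

/-- If `⁅x, u⁆` is a sum of elements `s j` intertwining `u` with some `v j` that commutes with `u`,
then `⁅x, u ^ k⁆` is the corresponding sum of divided differences. -/
lemma lie_pow_of_lie_eq_sum {A J : Type*} [Ring A] {t : Finset J} {x u : A} {v s : J → A}
    (hv : ∀ j, Commute u (v j)) (hx : ⁅x, u⁆ = ∑ j ∈ t, s j)
    (hs : ∀ j ∈ t, s j * u = v j * s j) (k : ℕ) :
    ⁅x, u ^ k⁆ = ∑ j ∈ t, (∑ a ∈ Finset.range k, u ^ a * v j ^ (k - 1 - a)) * s j := by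
  induction k with
  | zero => simp [Ring.lie_def]
  | succ k ih =>
    have hl : ⁅x, u ^ (k + 1)⁆ = ⁅x, u ^ k⁆ * u + u ^ k * ⁅x, u⁆ := by
      simp only [Ring.lie_def, pow_succ, sub_mul, mul_sub, mul_assoc]
      abel
    rw [hl, ih, hx, Finset.sum_mul, Finset.mul_sum, ← Finset.sum_add_distrib]
    refine Finset.sum_congr rfl fun j hj => ?_
    have hc : Commute (∑ a ∈ Finset.range k, u ^ a * v j ^ (k - 1 - a)) (v j) :=
      Commute.sum_left _ _ _ fun a _ =>
        ((hv j).pow_left a).mul_left ((Commute.refl _).pow_left _)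
    rw [Nat.add_sub_cancel, (hv j).geom_sum₂_succ_eq, ← hc.eq, mul_assoc, hs j hj, add_mul,
      mul_assoc, add_comm]

section Operators

attribute [local instance] LieRing.ofAssociativeRing

variable {ι K : Type*} [Field K]

/-- Multiplication by `σ ↦ a (σ i)` on functions on the symmetric group. -/
def coord (a : ι → K) (i : ι) : Module.End K (Equiv.Perm ι → K) :=
  LinearMap.mulLeft K fun σ => a (σ i)

@[simp] lemma coord_apply (a : ι → K) (i : ι) (f : Equiv.Perm ι → K) (σ : Equiv.Perm ι) :
    coord a i f σ = a (σ i) * f σ := rfl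

lemma lie_coord_coord (a b : ι → K) (i j : ι) : ⁅coord a i, coord b j⁆ = 0 := by
  refine LinearMap.ext fun f => funext fun σ => ?_
  simp [Ring.lie_def, mul_left_comm]

variable [DecidableEq ι]

/-- Right translation by the transposition of `i` and `k`. -/
def transp (K : Type*) [Field K] (i k : ι) : Module.End K (Equiv.Perm ι → K) :=
  LinearMap.funLeft K K fun σ => σ * Equiv.swap i k

/-- The transposition of `i` and `k`, weighted by the inverse difference of coordinates. It
vanishes for `i = k`. -/
def hop (l : ι → K) (i k : ι) : Module.End K (Equiv.Perm ι → K) :=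
  LinearMap.mulLeft K (fun σ => (l (σ i) - l (σ k))⁻¹) * transp K i k

@[simp] lemma transp_apply (i k : ι) (f : Equiv.Perm ι → K) (σ : Equiv.Perm ι) :
    transp K i k f σ = f (σ * Equiv.swap i k) := rfl

@[simp] lemma hop_apply (l : ι → K) (i k : ι) (f : Equiv.Perm ι → K) (σ : Equiv.Perm ι) :
    hop l i k f σ = (l (σ i) - l (σ k))⁻¹ * f (σ * Equiv.swap i k) := rfl

@[simp] lemma hop_self (l : ι → K) (i : ι) : hop l i i = 0 := by
  ext; simp

lemma lie_coord_hop_of_ne (a l : ι → K) {i j k : ι} (hj : i ≠ j) (hk : i ≠ k) :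
    ⁅coord a i, hop l j k⁆ = 0 := by
  refine LinearMap.ext fun f => funext fun σ => ?_
  simp [Ring.lie_def, Equiv.swap_apply_of_ne_of_ne hj hk, mul_left_comm]

lemma lie_coord_hop_add (a l : ι → K) (i j : ι) :
    ⁅coord a i, hop l j i⁆ + ⁅hop l i j, coord a j⁆ = 0 := by
  refine LinearMap.ext fun f => funext fun σ => ?_
  have h : (l (σ j) - l (σ i))⁻¹ = -(l (σ i) - l (σ j))⁻¹ := by rw [← inv_neg, neg_sub]
  simp [Ring.lie_def, h, Equiv.swap_comm j i]
  ring

lemma lie_hop_swap (l : ι → K) (i j : ι) : ⁅hop l i j, hop l j i⁆ = 0 := by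
  refine LinearMap.ext fun f => funext fun σ => ?_
  have h : (l (σ j) - l (σ i))⁻¹ = -(l (σ i) - l (σ j))⁻¹ := by rw [← inv_neg, neg_sub]
  simp [Ring.lie_def, Equiv.swap_comm j i, mul_assoc, h]

lemma lie_hop_of_disjoint (l : ι → K) {i j k m : ι} (hij : i ≠ j) (him : i ≠ m) (hkj : k ≠ j)
    (hkm : k ≠ m) : ⁅hop l i k, hop l j m⁆ = 0 := by
  refine LinearMap.ext fun f => funext fun σ => ?_
  have hc : Equiv.swap i k * Equiv.swap j m = Equiv.swap j m * Equiv.swap i k := by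
    ext x
    simp only [Equiv.Perm.mul_apply, Equiv.swap_apply_def]
    grind
  simp [Ring.lie_def, Equiv.swap_apply_of_ne_of_ne, hij, him, hkj, hkm, hij.symm, him.symm,
    hkj.symm, hkm.symm, mul_assoc, hc]
  ring

/-- The classical Yang–Baxter relation for the weighted transpositions. -/
lemma lie_hop_yangBaxter {l : ι → K} (hl : Function.Injective l) {i j m : ι} (hij : i ≠ j)
    (him : i ≠ m) (hjm : j ≠ m) :
    ⁅hop l i j, hop l j m⁆ + ⁅hop l i m, hop l j i⁆ + ⁅hop l i m, hop l j m⁆ = 0 := by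
  refine LinearMap.ext fun f => funext fun σ => ?_
  have h1 : l (σ i) - l (σ j) ≠ 0 := sub_ne_zero.2 fun h => hij (σ.injective (hl h))
  have h2 : l (σ i) - l (σ m) ≠ 0 := sub_ne_zero.2 fun h => him (σ.injective (hl h))
  have h3 : l (σ j) - l (σ m) ≠ 0 := sub_ne_zero.2 fun h => hjm (σ.injective (hl h))
  have h1' : l (σ j) - l (σ i) ≠ 0 := by rwa [← neg_sub, neg_ne_zero]
  have h2' : l (σ m) - l (σ i) ≠ 0 := by rwa [← neg_sub, neg_ne_zero]
  have h3' : l (σ m) - l (σ j) ≠ 0 := by rwa [← neg_sub, neg_ne_zero]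
  have p1 : Equiv.swap i j * Equiv.swap i m = Equiv.swap j m * Equiv.swap i j := by
    ext x
    simp only [Equiv.Perm.mul_apply, Equiv.swap_apply_def]
    grind
  have p2 : Equiv.swap i m * Equiv.swap j m = Equiv.swap j m * Equiv.swap i j := by
    ext x
    simp only [Equiv.Perm.mul_apply, Equiv.swap_apply_def]
    grind
  have q1 : Equiv.swap i j * Equiv.swap j m = Equiv.swap j m * Equiv.swap i m := by
    ext x
    simp only [Equiv.Perm.mul_apply, Equiv.swap_apply_def]
    grind
  have q2 : Equiv.swap i m * Equiv.swap i j = Equiv.swap j m * Equiv.swap i m := by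
    ext x
    simp only [Equiv.Perm.mul_apply, Equiv.swap_apply_def]
    grind
  simp [Ring.lie_def, Equiv.swap_apply_of_ne_of_ne, hij, him, hjm, hij.symm, him.symm,
    hjm.symm, mul_assoc, p1, p2, q1, q2, Equiv.swap_comm j i]
  field_simp
  ring

lemma transp_comm (i j : ι) : transp K i j = transp K j i := by
  rw [transp, transp, Equiv.swap_comm]

lemma lie_coord_hop {l : ι → K} (hl : Function.Injective l) {i j : ι} (hij : i ≠ j) :
    ⁅coord l i, hop l i j⁆ = transp K i j := by
  refine LinearMap.ext fun f => funext fun σ => ?_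
  have h : l (σ i) - l (σ j) ≠ 0 := sub_ne_zero.2 fun h => hij (σ.injective (hl h))
  simp [Ring.lie_def]
  field_simp

lemma lie_coord_hop_right {l : ι → K} (hl : Function.Injective l) {i j : ι} (hij : i ≠ j) :
    ⁅coord l i, hop l j i⁆ = -transp K i j := by
  refine LinearMap.ext fun f => funext fun σ => ?_
  have h : l (σ j) - l (σ i) ≠ 0 := sub_ne_zero.2 fun h => hij (σ.injective (hl h)).symm
  simp [Ring.lie_def, Equiv.swap_comm j i]
  field_simp
  ring

variable [Fintype ι]

lemma sum_sum_lie_hop {l : ι → K} (hl : Function.Injective l) {i j : ι} (hij : i ≠ j) :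
    ∑ k, ∑ m, ⁅hop l i k, hop l j m⁆ = 0 := by
  have key : ∀ k m, ⁅hop l i k, hop l j m⁆ = (if k = j then ⁅hop l i j, hop l j m⁆ else 0) +
      (if m = i then ⁅hop l i k, hop l j i⁆ else 0) +
      (if k = m then ⁅hop l i m, hop l j m⁆ else 0) := by
    intro k m
    rcases eq_or_ne k i with rfl | hki
    · rcases eq_or_ne k m with rfl | hkm
      · simp [hij]
      · simp [hij, hkm, hkm.symm]
    rcases eq_or_ne m j with rfl | hmj
    · rcases eq_or_ne k m with rfl | hkm
      · simp [hij.symm]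
      · simp [hij.symm, hkm]
    by_cases hkj : k = j
    · subst hkj
      by_cases hmi : m = i
      · subst hmi
        rw [if_pos rfl, if_pos rfl, if_neg hki, lie_hop_swap, add_zero, add_zero]
      · rw [if_pos rfl, if_neg hmi, if_neg hmj.symm, add_zero, add_zero]
    · by_cases hmi : m = i
      · subst hmi; simp [hkj, hki]
      · by_cases hkm : k = m
        · subst hkm; simp [hkj, hki]
        · rw [if_neg hkj, if_neg hmi, if_neg hkm, add_zero, add_zero,
            lie_hop_of_disjoint l hij (Ne.symm hmi) hkj hkm]
  rw [Finset.sum_congr rfl fun k _ => Finset.sum_congr rfl fun m _ => key k m]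
  simp_rw [Finset.sum_add_distrib]
  simp only [Finset.sum_ite_eq', Finset.sum_ite_eq, Finset.mem_univ, if_true]
  rw [Finset.sum_comm]
  simp only [Finset.sum_ite_eq', Finset.mem_univ, if_true]
  rw [← Finset.sum_add_distrib, ← Finset.sum_add_distrib]
  refine Finset.sum_eq_zero fun m _ => ?_
  rcases eq_or_ne i m with rfl | him
  · rw [lie_hop_swap, hop_self, zero_lie, add_zero, add_zero]
  rcases eq_or_ne j m with rfl | hjm
  · rw [lie_hop_swap, hop_self, lie_zero, add_zero, add_zero]
  exact lie_hop_yangBaxter hl hij him hjm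

/-- The Dunkl operators of the rational Cherednik algebra at `t = 0`, acting on functions on the
symmetric group. -/
def dunkl (l α : ι → K) (i : ι) : Module.End K (Equiv.Perm ι → K) :=
  coord α i + ∑ k, hop l i k

lemma dunkl_apply (l α : ι → K) (i : ι) (f : Equiv.Perm ι → K) (σ : Equiv.Perm ι) :
    dunkl l α i f σ = α (σ i) * f σ + ∑ k, (l (σ i) - l (σ k))⁻¹ * f (σ * Equiv.swap i k) := by
  simp [dunkl]

lemma commute_dunkl {l : ι → K} (hl : Function.Injective l) (α : ι → K) (i j : ι) :
    Commute (dunkl l α i) (dunkl l α j) := by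
  rcases eq_or_ne i j with rfl | hij
  · exact Commute.refl _
  have h1 : ∑ k, ⁅coord α i, hop l j k⁆ = ⁅coord α i, hop l j i⁆ :=
    Finset.sum_eq_single i (fun k _ hk => lie_coord_hop_of_ne α l hij hk.symm) (by simp)
  have h2 : ∑ k, ⁅hop l i k, coord α j⁆ = ⁅hop l i j, coord α j⁆ :=
    Finset.sum_eq_single j (fun k _ hk => by
      rw [← lie_skew, lie_coord_hop_of_ne α l hij.symm hk.symm, neg_zero]) (by simp)
  have h : ⁅dunkl l α i, dunkl l α j⁆ = 0 := by
    rw [dunkl, dunkl, add_lie, lie_add, lie_add, lie_coord_coord, lie_sum, sum_lie, sum_lie, h1, h2]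
    simp_rw [lie_sum]
    rw [sum_sum_lie_hop hl hij, zero_add, add_zero, lie_coord_hop_add]
  exact commute_iff_lie_eq.2 h

lemma transp_mul_dunkl (l α : ι → K) (i j : ι) :
    transp K i j * dunkl l α j = dunkl l α i * transp K i j := by
  refine LinearMap.ext fun f => funext fun σ => ?_
  simp only [Module.End.mul_apply, transp_apply, dunkl_apply, Equiv.Perm.mul_apply,
    Equiv.swap_apply_right]
  congr 1
  rw [← Equiv.sum_comp (Equiv.swap i j)]
  refine Finset.sum_congr rfl fun k _ => ?_
  have h := Equiv.swap_mul_eq_mul_swap (Equiv.swap i j) i k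
  rw [Equiv.swap_inv, Equiv.swap_apply_left] at h
  rw [Equiv.swap_apply_self, mul_assoc, mul_assoc, ← h]

lemma lie_coord_dunkl_of_ne {l : ι → K} (hl : Function.Injective l) (α : ι → K) {i j : ι}
    (hij : i ≠ j) : ⁅coord l i, dunkl l α j⁆ = -transp K i j := by
  rw [dunkl, lie_add, lie_coord_coord, zero_add, lie_sum, ← lie_coord_hop_right hl hij]
  exact Finset.sum_eq_single i (fun k _ hk => lie_coord_hop_of_ne l l hij hk.symm) (by simp)

lemma lie_coord_dunkl_self {l : ι → K} (hl : Function.Injective l) (α : ι → K) (i : ι) :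
    ⁅coord l i, dunkl l α i⁆ = ∑ k ∈ Finset.univ.erase i, transp K i k := by
  rw [dunkl, lie_add, lie_coord_coord, zero_add, lie_sum,
    ← Finset.add_sum_erase _ _ (Finset.mem_univ i), hop_self, lie_zero, zero_add]
  exact Finset.sum_congr rfl fun k hk => lie_coord_hop hl (Finset.ne_of_mem_erase hk).symm

lemma lie_coord_dunkl_pow_of_ne {l : ι → K} (hl : Function.Injective l) (α : ι → K) {i j : ι}
    (hij : i ≠ j) (k : ℕ) : ⁅coord l i, dunkl l α j ^ k⁆ =
      -((∑ a ∈ Finset.range k, dunkl l α j ^ a * dunkl l α i ^ (k - 1 - a)) * transp K i j) := by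
  have h := lie_pow_of_lie_eq_sum (t := {()}) (x := coord l i) (u := dunkl l α j)
    (v := fun _ => dunkl l α i) (s := fun _ => -transp K i j) (fun _ => commute_dunkl hl α j i)
    (by rw [Finset.sum_singleton]; exact lie_coord_dunkl_of_ne hl α hij)
    (fun _ _ => (neg_mul _ _).trans (((congrArg _ (transp_mul_dunkl l α i j))).trans
      (mul_neg _ _).symm)) k
  rw [Finset.sum_singleton] at h
  exact h.trans (mul_neg (_ : Module.End K (Equiv.Perm ι → K)) _)

lemma lie_coord_dunkl_pow_self {l : ι → K} (hl : Function.Injective l) (α : ι → K) (i : ι)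
    (k : ℕ) : ⁅coord l i, dunkl l α i ^ k⁆ = ∑ j ∈ Finset.univ.erase i,
      (∑ a ∈ Finset.range k, dunkl l α i ^ a * dunkl l α j ^ (k - 1 - a)) * transp K i j :=
  lie_pow_of_lie_eq_sum (fun j => commute_dunkl hl α i j) (lie_coord_dunkl_self hl α i)
    (fun j _ => by rw [transp_comm i j, transp_mul_dunkl]) k

lemma commute_coord_sum_dunkl_pow {l : ι → K} (hl : Function.Injective l) (α : ι → K) (i : ι)
    (k : ℕ) : Commute (coord l i) (∑ j, dunkl l α j ^ k) := by
  have h : ⁅coord l i, ∑ j, dunkl l α j ^ k⁆ = 0 := by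
    rw [lie_sum, ← Finset.add_sum_erase _ _ (Finset.mem_univ i), lie_coord_dunkl_pow_self hl,
      ← Finset.sum_add_distrib]
    refine Finset.sum_eq_zero fun j hj => ?_
    rw [lie_coord_dunkl_pow_of_ne hl α (Finset.ne_of_mem_erase hj).symm,
      (commute_dunkl hl α i j).geom_sum₂_comm, add_neg_cancel]
  exact commute_iff_lie_eq.2 h

/-- An operator commuting with all coordinates is the multiplication by its value on `1`. -/
lemma apply_eq_apply_one_mul {l : ι → K} (hl : Function.Injective l)
    {S : Module.End K (Equiv.Perm ι → K)} (hS : ∀ i, Commute (coord l i) S)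
    (f : Equiv.Perm ι → K) (σ : Equiv.Perm ι) : S f σ = S 1 σ * f σ := by
  have hd : ∀ τ, τ ≠ σ → S (fun ρ => if τ = ρ then 1 else 0) σ = 0 := by
    intro τ hτ
    obtain ⟨i, hi⟩ : ∃ i, τ i ≠ σ i := by
      by_contra! h
      exact hτ (Equiv.ext h)
    have hx : coord l i (fun ρ => if τ = ρ then 1 else 0) =
        l (τ i) • fun ρ => if τ = ρ then (1 : K) else 0 := by
      ext ρ
      by_cases h : τ = ρ <;> simp [h]
    have h := congrFun (LinearMap.congr_fun (hS i) fun ρ => if τ = ρ then 1 else 0) σ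
    rw [Module.End.mul_apply, Module.End.mul_apply, hx, map_smul, coord_apply, Pi.smul_apply,
      smul_eq_mul] at h
    by_contra h0
    exact hi (hl (mul_right_cancel₀ h0 h)).symm
  have hf : ∀ g, S g σ = g σ * S (fun ρ => if σ = ρ then 1 else 0) σ := by
    intro g
    rw [S.pi_apply_eq_sum_univ g, Finset.sum_apply]
    refine (Finset.sum_eq_single σ (fun τ _ hτ => ?_) (by simp)).trans rfl
    rw [Pi.smul_apply, hd τ hτ, smul_zero]
  rw [hf f, hf 1, Pi.one_apply, one_mul, mul_comm]

/-- The Calogero–Moser matrix with positions `l` and diagonal `α`. -/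
def cmMatrix (l α : ι → K) : Matrix ι ι K :=
  Matrix.diagonal α + Matrix.of fun i j => (l i - l j)⁻¹

lemma dunkl_apply_comp (l α g : ι → K) (i : ι) :
    dunkl l α i (fun σ => g (σ i)) = fun σ => (cmMatrix l α).mulVec g (σ i) := by
  ext σ
  rw [dunkl_apply, cmMatrix, Matrix.add_mulVec, Pi.add_apply, Matrix.mulVec_diagonal,
    Matrix.mulVec, dotProduct]
  simp only [Matrix.of_apply, Equiv.Perm.mul_apply, Equiv.swap_apply_left]
  rw [Equiv.sum_comp σ fun j => (l (σ i) - l j)⁻¹ * g j]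

lemma dunkl_pow_apply_one (l α : ι → K) (i : ι) (k : ℕ) :
    (dunkl l α i ^ k) 1 = fun σ => (cmMatrix l α ^ k).mulVec 1 (σ i) := by
  induction k with
  | zero => ext; simp
  | succ k ih =>
    rw [pow_succ', Module.End.mul_apply, ih, dunkl_apply_comp, Matrix.mulVec_mulVec, pow_succ']

/-- The Calogero–Moser relation: `[X, Z] + 1` is the all-ones matrix. -/
lemma lie_diagonal_cmMatrix_add_one {l : ι → K} (hl : Function.Injective l) (α : ι → K) :
    Matrix.diagonal l * cmMatrix l α - cmMatrix l α * Matrix.diagonal l + 1 =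
      Matrix.of fun _ _ => 1 := by
  ext i j
  rcases eq_or_ne i j with rfl | hij
  · simp [Matrix.diagonal_mul, Matrix.mul_diagonal, mul_comm]
  · have h : l i - l j ≠ 0 := sub_ne_zero.2 fun h => hij (hl h)
    simp [Matrix.diagonal_mul, Matrix.mul_diagonal, cmMatrix, hij]
    field_simp

lemma sum_cmMatrix_pow_mulVec_one {l : ι → K} (hl : Function.Injective l) (α : ι → K) (k : ℕ) :
    ∑ i, (cmMatrix l α ^ k).mulVec 1 i = (cmMatrix l α ^ k).trace := by
  have h := congr(Matrix.trace ($(lie_diagonal_cmMatrix_add_one hl α) * cmMatrix l α ^ k))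
  rw [add_mul, sub_mul, one_mul, Matrix.trace_add, Matrix.trace_sub,
    Matrix.mul_assoc (cmMatrix l α), Matrix.trace_mul_comm (cmMatrix l α), Matrix.mul_assoc,
    Matrix.mul_assoc, ← pow_succ, ← pow_succ', sub_self, zero_add] at h
  rw [h]
  simp only [Matrix.trace, Matrix.diag_apply, Matrix.mul_apply, Matrix.of_apply, one_mul,
    Matrix.mulVec, dotProduct, Pi.one_apply, mul_one]
  exact Finset.sum_comm

lemma sum_dunkl_pow_apply {l : ι → K} (hl : Function.Injective l) (α : ι → K) (k : ℕ)
    (f : Equiv.Perm ι → K) :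
    (∑ i, dunkl l α i ^ k) f = (cmMatrix l α ^ k).trace • f := by
  ext σ
  rw [apply_eq_apply_one_mul hl (fun i => commute_coord_sum_dunkl_pow hl α i k) f σ,
    Pi.smul_apply, smul_eq_mul, LinearMap.sum_apply, Finset.sum_apply,
    ← sum_cmMatrix_pow_mulVec_one hl α]
  simp only [dunkl_pow_apply_one]
  rw [Equiv.sum_comp σ]

end Operators

lemma isRoot_charpoly_of_dunkl_apply {ι K : Type*} [Fintype ι] [DecidableEq ι] [Field K]
    [CharZero K] {l : ι → K} (hl : Function.Injective l) {α w : ι → K} {f : Equiv.Perm ι → K}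
    (hf : f ≠ 0) (h : ∀ i, dunkl l α i f = w i • f) (i : ι) :
    (cmMatrix l α).charpoly.IsRoot (w i) := by
  refine isRoot_charpoly_of_sum_pow_eq_trace _ w (fun k => smul_left_injective K hf ?_) i
  have hpow : ∀ j, (dunkl l α j ^ k) f = w j ^ k • f := by
    intro j
    induction k with
    | zero => simp
    | succ k ih => rw [pow_succ', Module.End.mul_apply, ih, map_smul, h, smul_smul, pow_succ]
  change (∑ j, w j ^ k) • f = (cmMatrix l α ^ k).trace • f
  rw [← sum_dunkl_pow_apply hl, LinearMap.sum_apply, Finset.sum_smul]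
  exact Finset.sum_congr rfl fun j _ => (hpow j).symm

/-- If the joint eigenvalues `w` of the Dunkl operators are real, then so is `α`: as equations for
`α`, the eigenvalue equations involve Hermitian operators only. -/
lemma im_eq_zero_of_dunkl_apply {ι : Type*} [Fintype ι] [DecidableEq ι] (lam : ι → ℝ)
    {α w : ι → ℂ} (hw : ∀ i, (w i).im = 0) {f : Equiv.Perm ι → ℂ} (hf : f ≠ 0)
    (h : ∀ i, dunkl (fun j => (lam j : ℂ)) α i f = w i • f) (i : ι) : (α i).im = 0 := by
  have heq : ∀ σ : Equiv.Perm ι, α i * f σ = w (σ⁻¹ i) * f σ -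
      ∑ q, ((lam i : ℂ) - lam q)⁻¹ * f (Equiv.swap i q * σ) := by
    intro σ
    have h1 := congrFun (h (σ⁻¹ i)) σ
    rw [dunkl_apply, ← Equiv.sum_comp σ⁻¹, Pi.smul_apply, smul_eq_mul] at h1
    simp only [Equiv.mul_swap_eq_swap_mul, ← Equiv.Perm.mul_apply, mul_inv_cancel,
      Equiv.Perm.one_apply] at h1
    rw [← h1, add_sub_cancel_right]
  have hsum : α i * ∑ σ, f σ * (starRingEnd ℂ) (f σ) =
      ∑ σ, w (σ⁻¹ i) * (f σ * (starRingEnd ℂ) (f σ)) - ∑ q, ((lam i : ℂ) - lam q)⁻¹ *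
        ∑ σ, f (Equiv.swap i q * σ) * (starRingEnd ℂ) (f σ) := by
    simp_rw [Finset.mul_sum]
    rw [Finset.sum_comm, ← Finset.sum_sub_distrib]
    refine Finset.sum_congr rfl fun σ _ => ?_
    rw [← mul_assoc, heq, sub_mul, Finset.sum_mul, mul_assoc]
    simp_rw [mul_assoc]
  have hherm : ∀ q, (starRingEnd ℂ) (∑ σ, f (Equiv.swap i q * σ) * (starRingEnd ℂ) (f σ)) =
      ∑ σ, f (Equiv.swap i q * σ) * (starRingEnd ℂ) (f σ) := by
    intro q
    rw [map_sum, ← Equiv.sum_comp (Equiv.mulLeft (Equiv.swap i q))]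
    refine Finset.sum_congr rfl fun σ _ => ?_
    simp [mul_comm]
  have hw' : ∀ j, (starRingEnd ℂ) (w j) = w j := fun j => Complex.conj_eq_iff_im.2 (hw j)
  have hN : ∑ σ, f σ * (starRingEnd ℂ) (f σ) = ((∑ σ, Complex.normSq (f σ) : ℝ) : ℂ) := by
    simp [Complex.mul_conj]
  have hpos : (∑ σ, Complex.normSq (f σ)) ≠ 0 := by
    obtain ⟨σ, hσ⟩ := Function.ne_iff.1 hf
    exact (Finset.sum_pos' (fun τ _ => Complex.normSq_nonneg _)
      ⟨σ, Finset.mem_univ _, Complex.normSq_pos.2 hσ⟩).ne'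
  have hreal : (starRingEnd ℂ) (α i * ∑ σ, f σ * (starRingEnd ℂ) (f σ)) =
      α i * ∑ σ, f σ * (starRingEnd ℂ) (f σ) := by
    rw [hsum, map_sub, map_sum, map_sum]
    congr 1
    · refine Finset.sum_congr rfl fun σ _ => ?_
      rw [Complex.mul_conj, map_mul, hw', Complex.conj_ofReal]
    · refine Finset.sum_congr rfl fun q _ => ?_
      rw [map_mul, hherm, map_inv₀, map_sub, Complex.conj_ofReal, Complex.conj_ofReal]
  rw [Complex.conj_eq_iff_im, hN, Complex.im_mul_ofReal] at hreal
  exact (mul_eq_zero.1 hreal).resolve_right hpos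

end CalogeroMoser

/-- If `λ₁, …, λₙ` are distinct real numbers and the Calogero–Moser matrix `Z`
(with `Z i i = α i` and `Z i j = (λ i − λ j)⁻¹` for `i ≠ j`) has only real eigenvalues, then every
`α i` is real. -/
theorem calogero_moser_matrix_real_diag (n : ℕ) (lam : Fin n → ℝ)
    (hlam : Function.Injective lam) (α : Fin n → ℂ)
    (Z : Matrix (Fin n) (Fin n) ℂ)
    (hZdef : ∀ i j, Z i j = if i = j then α i else ((lam i : ℂ) - (lam j : ℂ))⁻¹)
    (hZ : ∀ z : ℂ, (Matrix.charpoly Z).IsRoot z → z.im = 0) :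
    ∀ i, (α i).im = 0 := by
  have hl : Function.Injective fun i => (lam i : ℂ) := Complex.ofReal_injective.comp hlam
  have hZ' : Z = CalogeroMoser.cmMatrix (fun i => (lam i : ℂ)) α := by
    ext i j
    rcases eq_or_ne i j with rfl | hij
    · simp [hZdef, CalogeroMoser.cmMatrix]
    · simp [hZdef, CalogeroMoser.cmMatrix, hij]
  obtain ⟨w, f, hf, hw⟩ := CalogeroMoser.exists_joint_eigenvector
    (CalogeroMoser.dunkl (fun i => (lam i : ℂ)) α) (CalogeroMoser.commute_dunkl hl α)
  exact CalogeroMoser.im_eq_zero_of_dunkl_apply lam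
    (fun i => hZ _ (hZ' ▸ CalogeroMoser.isRoot_charpoly_of_dunkl_apply hl hf hw i)) hf hw
end
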